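/- arXiv:2106.00303 — 3 statements merged into one kernel-verified Lean document; each statement's English description precedes it below -/
import Mathlib

section
/- Let n ≥ 1 be an integer, let 0 < s < 1/2, α ∈ (2s, 1) and C₀ ≥ 1, and let μ be a Radon measure on ℝ^{n+1} satisfying the density-control condition θ_μ(x,r) ≤ C₀ (R/r)^s θ_μ(x,R) for all x ∈ supp μ and all 0 < r < R < ∞. Then there is a constant M, depending only on n, s, α and C₀, such that for every ball B ⊂ ℝ^{n+1}: ∫ ∫₀^∞ r^{α} θ_{μ|_B}(x,r)² (dr/r) d(μ|_B)(x) ≤ M r(B)^{α} θ_μ(2B)² μ(2B). -/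
open MeasureTheory Metric Set ENNReal

noncomputable section

/-- The (topological) support of a measure on a metric space: the set of points all of whose
balls have positive measure. -/
def measSupport {X : Type*} [PseudoMetricSpace X] [MeasurableSpace X]
    (μ : Measure X) : Set X :=
  {x | ∀ r : ℝ, 0 < r → 0 < μ (ball x r)}

/-- The `n`-dimensional density `θ_μ(x,r) = μ(B(x,r))/rⁿ`. -/
def ballDensity (n : ℕ) (μ : Measure (EuclideanSpace ℝ (Fin (n + 1))))
    (x : EuclideanSpace ℝ (Fin (n + 1))) (r : ℝ) : ℝ≥0∞ :=
  μ (ball x r) / ENNReal.ofReal (r ^ n)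

/-- The Wolff-type energy with parameter `a`:
`𝔼^{(a)}(μ) = ∫∫₀^∞ ( μ(B(x,r))/r^{n−a/2} )² (dr/r) dμ(x)
            = ∫∫₀^∞ r^a θ_μ(x,r)² (dr/r) dμ(x)`.
For `a = 3/4` this is the energy `𝔼(μ)` of the paper. -/
def wolffEnergy (n : ℕ) (a : ℝ) (μ : Measure (EuclideanSpace ℝ (Fin (n + 1)))) : ℝ≥0∞ :=
  ∫⁻ x, (∫⁻ r in Ioi (0 : ℝ),
      (μ (ball x r) / ENNReal.ofReal (r ^ ((n : ℝ) - a / 2))) ^ 2 * (ENNReal.ofReal r)⁻¹) ∂μ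

lemma s8_int_near (β ρ : ℝ) (hβ : 0 < β) (hρ : 0 < ρ) :
    ∫⁻ r in Ioc 0 ρ, ENNReal.ofReal (r ^ (β - 1)) = ENNReal.ofReal (ρ ^ β / β) := by
  have hi : IntegrableOn (fun r : ℝ => r ^ (β - 1)) (Ioc 0 ρ) := by
    rw [← intervalIntegrable_iff_integrableOn_Ioc_of_le hρ.le]
    exact intervalIntegral.intervalIntegrable_rpow' (by linarith)
  rw [← ofReal_integral_eq_lintegral_ofReal hi, ← intervalIntegral.integral_of_le hρ.le,
    integral_rpow (Or.inl (by linarith))]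
  · simp [hβ.ne']
  · filter_upwards [ae_restrict_mem measurableSet_Ioc] with r hr
    exact Real.rpow_nonneg hr.1.le _

lemma s8_int_far (γ ρ : ℝ) (hγ : 0 < γ) (hρ : 0 < ρ) :
    ∫⁻ r in Ioi ρ, ENNReal.ofReal (r ^ (-γ - 1)) = ENNReal.ofReal (ρ ^ (-γ) / γ) := by
  have hi : IntegrableOn (fun r : ℝ => r ^ (-γ - 1)) (Ioi ρ) :=
    integrableOn_Ioi_rpow_of_lt (by linarith) hρ
  rw [← ofReal_integral_eq_lintegral_ofReal hi, integral_Ioi_rpow_of_lt (by linarith) hρ]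
  · congr 1
    rw [show -γ - 1 + 1 = -γ by ring, neg_div_neg_eq]
  · filter_upwards [ae_restrict_mem measurableSet_Ioi] with r hr
    exact Real.rpow_nonneg (hρ.trans hr).le _

lemma s8_point (a m : ℝ≥0∞) (c p r : ℝ) (hc : 0 ≤ c) (hp : 0 < p) (hr : 0 < r)
    (h : a ≤ ENNReal.ofReal c * m) :
    (a / ENNReal.ofReal p) ^ 2 * (ENNReal.ofReal r)⁻¹ ≤
      m ^ 2 * ENNReal.ofReal ((c / p) ^ 2 / r) := by
  calc (a / ENNReal.ofReal p) ^ 2 * (ENNReal.ofReal r)⁻¹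
      ≤ (ENNReal.ofReal c * m / ENNReal.ofReal p) ^ 2 * (ENNReal.ofReal r)⁻¹ := by gcongr
    _ = m ^ 2 * ENNReal.ofReal ((c / p) ^ 2 / r) := by
        rw [ENNReal.ofReal_div_of_pos hr, ENNReal.ofReal_pow (by positivity),
          ENNReal.ofReal_div_of_pos hp]
        simp only [div_eq_mul_inv]
        ring

lemma s8_decay (n : ℕ) (μ : Measure (EuclideanSpace ℝ (Fin (n + 1))))
    (x : EuclideanSpace ℝ (Fin (n + 1))) (r ρ K : ℝ) (hr : 0 < r) (hρ : 0 < ρ) (hK : 0 ≤ K)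
    (h : ballDensity n μ x r ≤ ENNReal.ofReal K * ballDensity n μ x ρ) :
    μ (ball x r) ≤ ENNReal.ofReal (K * r ^ n / ρ ^ n) * μ (ball x ρ) := by
  unfold ballDensity at h
  have hrn : 0 < r ^ n := by positivity
  rw [ENNReal.div_le_iff (by simpa using hrn) (by simp)] at h
  refine h.trans_eq ?_
  rw [ENNReal.ofReal_div_of_pos (by positivity), ENNReal.ofReal_mul hK]
  simp only [div_eq_mul_inv]
  ring

lemma s8_alg_near (n : ℕ) (s α C r ρ : ℝ) (hr : 0 < r) (hρ : 0 < ρ) :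
    ((C * (ρ / r) ^ s * r ^ n / ρ ^ n) / r ^ ((n : ℝ) - α / 2)) ^ 2 / r =
      (C ^ 2 * ρ ^ (2 * s - 2 * n)) * r ^ ((α - 2 * s) - 1) := by
  rw [Real.div_rpow hρ.le hr.le, ← Real.rpow_natCast r n, ← Real.rpow_natCast ρ n]
  have e1 : ρ ^ (2 * s - 2 * n) = (ρ ^ s / ρ ^ (n : ℝ)) ^ 2 := by
    rw [← Real.rpow_sub hρ, ← Real.rpow_natCast, ← Real.rpow_mul hρ.le]
    congr 1; push_cast; ring
  have e2 : r ^ ((α - 2 * s) - 1) = (r ^ (n : ℝ) / r ^ s / r ^ ((n : ℝ) - α / 2)) ^ 2 / r := by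
    rw [← Real.rpow_sub hr, ← Real.rpow_sub hr, ← Real.rpow_natCast, ← Real.rpow_mul hr.le,
      Real.rpow_sub_one hr.ne']
    congr 2; push_cast; ring
  rw [e1, e2]
  simp only [div_eq_mul_inv]
  ring

lemma s8_alg_far (n : ℕ) (α r : ℝ) (hr : 0 < r) :
    (1 / r ^ ((n : ℝ) - α / 2)) ^ 2 / r = r ^ (-(2 * n - α) - 1) := by
  rw [one_div, ← Real.rpow_neg hr.le, ← Real.rpow_natCast, ← Real.rpow_mul hr.le,
    Real.rpow_sub_one hr.ne']
  congr 2; push_cast; ring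

lemma s8_ae_support {n : ℕ} (μ : Measure (EuclideanSpace ℝ (Fin (n + 1)))) :
    ∀ᵐ x ∂μ, x ∈ measSupport μ := by
  filter_upwards [Measure.support_mem_ae (μ := μ)] with x hx r hr
  exact (Measure.mem_support_iff_forall x).1 hx _ (ball_mem_nhds x hr)

lemma s8_inner (n : ℕ) (hn : 1 ≤ n) (s α C₀ : ℝ)
    (hs0 : 0 < s) (hα1 : 2 * s < α) (hα2 : α < 1) (hC₀ : 1 ≤ C₀)
    (μ : Measure (EuclideanSpace ℝ (Fin (n + 1))))
    (z x : EuclideanSpace ℝ (Fin (n + 1))) (ρ : ℝ) (hρ : 0 < ρ) (hx : x ∈ ball z ρ)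
    (H : ∀ r : ℝ, 0 < r → r < ρ → ballDensity n μ x r ≤
              ENNReal.ofReal (C₀ * (ρ / r) ^ s) * ballDensity n μ x ρ) :
    (∫⁻ r in Ioi (0 : ℝ), ((μ.restrict (ball z ρ)) (ball x r) /
        ENNReal.ofReal (r ^ ((n : ℝ) - α / 2))) ^ 2 * (ENNReal.ofReal r)⁻¹) ≤
      μ (ball z (2 * ρ)) ^ 2 * ENNReal.ofReal
        ((C₀ ^ 2 / (α - 2 * s) + 1 / (2 * n - α)) * ρ ^ (α - 2 * n)) := by
  have hn' : (1 : ℝ) ≤ n := by exact_mod_cast hn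
  have hb : 0 < α - 2 * s := by linarith
  have hg : 0 < 2 * (n : ℝ) - α := by linarith
  have hsub : ball x ρ ⊆ ball z (2 * ρ) := by
    apply ball_subset_ball'
    have := mem_ball.1 hx
    linarith
  have hsub2 : ball z ρ ⊆ ball z (2 * ρ) := ball_subset_ball (by linarith)
  set m := μ (ball z (2 * ρ)) with hm
  have hnear : ∀ r ∈ Ioc 0 ρ, ((μ.restrict (ball z ρ)) (ball x r) /
        ENNReal.ofReal (r ^ ((n : ℝ) - α / 2))) ^ 2 * (ENNReal.ofReal r)⁻¹ ≤
      m ^ 2 * ENNReal.ofReal (C₀ ^ 2 * ρ ^ (2 * s - 2 * n)) *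
        ENNReal.ofReal (r ^ ((α - 2 * s) - 1)) := by
    intro r hr
    have hr0 := hr.1
    rw [mul_assoc, ← ENNReal.ofReal_mul (by positivity), ← s8_alg_near n s α C₀ r ρ hr0 hρ]
    apply s8_point _ _ _ _ _ (by positivity) (by positivity) hr0
    refine (Measure.restrict_apply_le _ _).trans ?_
    rcases hr.2.lt_or_eq with hlt | rfl
    · refine (s8_decay n μ x r ρ _ hr0 hρ (by positivity) (H r hr0 hlt)).trans ?_
      exact mul_le_mul' le_rfl (measure_mono hsub)
    · have : C₀ * (r / r) ^ s * r ^ n / r ^ n = C₀ := by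
        rw [div_self hr0.ne', Real.one_rpow]; field_simp
      rw [this]
      calc μ (ball x r) ≤ 1 * m := by rw [one_mul]; exact measure_mono hsub
        _ ≤ _ := by gcongr; simpa using hC₀
  have hfar : ∀ r ∈ Ioi ρ, ((μ.restrict (ball z ρ)) (ball x r) /
        ENNReal.ofReal (r ^ ((n : ℝ) - α / 2))) ^ 2 * (ENNReal.ofReal r)⁻¹ ≤
      m ^ 2 * ENNReal.ofReal (r ^ (-(2 * n - α) - 1)) := by
    intro r hr
    have hr0 : 0 < r := hρ.trans hr
    rw [← s8_alg_far n α r hr0]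
    apply s8_point _ _ _ _ _ (by positivity) (by positivity) hr0
    rw [ENNReal.ofReal_one, one_mul]
    refine (measure_mono (subset_univ _)).trans ?_
    rw [Measure.restrict_apply_univ]
    exact measure_mono hsub2
  rw [← Ioc_union_Ioi_eq_Ioi hρ.le]
  refine (lintegral_union_le _ _ _).trans ?_
  refine (add_le_add (setLIntegral_mono' measurableSet_Ioc hnear)
    (setLIntegral_mono' measurableSet_Ioi hfar)).trans_eq ?_
  rw [lintegral_const_mul _ (by fun_prop), lintegral_const_mul _ (by fun_prop),
    s8_int_near _ _ hb hρ, s8_int_far _ _ hg hρ, mul_assoc,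
    ← ENNReal.ofReal_mul (by positivity), ← mul_add, ← ENNReal.ofReal_add (by positivity)
    (by positivity)]
  congr 2
  have e1 : ρ ^ (α - 2 * n) = ρ ^ (2 * s - 2 * n) * ρ ^ (α - 2 * s) := by
    rw [← Real.rpow_add hρ]; congr 1; ring
  have e2 : ρ ^ (-(2 * n - α)) = ρ ^ (α - 2 * n) := by congr 1; ring
  rw [e2, add_mul]
  nth_rw 2 [e1]
  ring

/-- **Remark 1.2 of Dąbrowski–Tolsa (precise form):** the density-decay condition
`θ_μ(x,r) ≤ C₀ (R/r)^s θ_μ(x,R)` for `x ∈ supp μ` and `0 < r < R`, with `0 < s < 1/2`,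
implies the subcritical Wolff energy condition with any exponent `α ∈ (2s, 1)`:
`∫∫₀^∞ r^α θ_{μ|_B}(x,r)² (dr/r) d(μ|_B)(x) ≤ M r(B)^α θ_μ(2B)² μ(2B)` for all balls `B`. -/
theorem statement_8 (n : ℕ) (hn : 1 ≤ n) (s α C₀ : ℝ)
    (hs0 : 0 < s) (hs1 : s < 1 / 2) (hα1 : 2 * s < α) (hα2 : α < 1) (hC₀ : 1 ≤ C₀) :
    ∃ M : ℝ, 0 < M ∧
      ∀ (μ : Measure (EuclideanSpace ℝ (Fin (n + 1)))),
        IsLocallyFiniteMeasure μ →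
        (∀ x ∈ measSupport μ, ∀ r R : ℝ, 0 < r → r < R →
            ballDensity n μ x r ≤
              ENNReal.ofReal (C₀ * (R / r) ^ s) * ballDensity n μ x R) →
        ∀ (z : EuclideanSpace ℝ (Fin (n + 1))) (ρ : ℝ), 0 < ρ →
          wolffEnergy n α (μ.restrict (ball z ρ)) ≤
            ENNReal.ofReal (M * ρ ^ α) *
              ballDensity n μ z (2 * ρ) ^ 2 * μ (ball z (2 * ρ)) := by
  have hn' : (1 : ℝ) ≤ n := by exact_mod_cast hn
  have hb : 0 < α - 2 * s := by linarith
  have hg : 0 < 2 * (n : ℝ) - α := by linarith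
  refine ⟨4 ^ n * (C₀ ^ 2 / (α - 2 * s) + 1 / (2 * n - α)), by positivity, ?_⟩
  intro μ _ H z ρ hρ
  set m := μ (ball z (2 * ρ)) with hm
  set D := C₀ ^ 2 / (α - 2 * s) + 1 / (2 * n - α) with hD
  have hD0 : 0 < D := by positivity
  unfold wolffEnergy
  have hae : ∀ᵐ x ∂(μ.restrict (ball z ρ)),
      (∫⁻ r in Ioi (0 : ℝ), ((μ.restrict (ball z ρ)) (ball x r) /
        ENNReal.ofReal (r ^ ((n : ℝ) - α / 2))) ^ 2 * (ENNReal.ofReal r)⁻¹) ≤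
      m ^ 2 * ENNReal.ofReal (D * ρ ^ (α - 2 * n)) := by
    filter_upwards [ae_restrict_mem measurableSet_ball,
      ae_restrict_of_ae (s8_ae_support μ)] with x hx hxs
    exact s8_inner n hn s α C₀ hs0 hα1 hα2 hC₀ μ z x ρ hρ hx
      (fun r hr hr' => H x hxs r ρ hr hr')
  refine (lintegral_mono_ae hae).trans ?_
  rw [lintegral_const, Measure.restrict_apply_univ]
  refine mul_le_mul' (le_of_eq ?_) (measure_mono (ball_subset_ball (by linarith)))
  have e : D * ρ ^ (α - 2 * n) = 4 ^ n * D * ρ ^ α / ((2 * ρ) ^ n) ^ 2 := by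
    rw [Real.rpow_sub hρ, show (2 * (n : ℝ)) = ((2 * n : ℕ) : ℝ) by push_cast; ring,
      Real.rpow_natCast, ← pow_mul, mul_pow, mul_comm n 2, pow_mul 2 2 n]
    norm_num
    field_simp
  unfold ballDensity
  rw [e, ENNReal.ofReal_div_of_pos (by positivity), ENNReal.ofReal_pow (by positivity)]
  rw [← hm]
  simp only [div_eq_mul_inv, mul_pow, ENNReal.inv_pow]
  ring

end
end

section
/- Let d ≥ 1 and n ≥ 1 be integers and let γ ∈ (0,1). There are constants C₀ = C₀(d) > 1, A₀ = A₀(d,γ) > 5000 C₀ and C(γ,d) with the following property. Let μ be a compactly supported Radon measure on ℝ^d with μ(B(x,r)) ≤ c r^n for all x ∈ supp μ and r > 0, and set E = supp μ. Then there exists a family D_μ = ⋃_{k ≥ k₀} D_{μ,k} of Borel subsets ('cubes') of E such that: (1) for each k, the cubes of D_{μ,k} form a partition of E, and if k < l, Q ∈ D_{μ,l}, R ∈ D_{μ,k}, then either Q ∩ R = ∅ or Q ⊂ R; (2) each Q ∈ D_{μ,k} has a center x_Q ∈ E and a radius r(Q) ∈ [A₀^{−k}, C₀ A₀^{−k}]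 with E ∩ B(x_Q, r(Q)) ⊂ Q ⊂ E ∩ B(x_Q, 28 r(Q)), and for each fixed k the balls B(x_Q, 5 r(Q)), Q ∈ D_{μ,k}, are pairwise disjoint; (3) (small boundaries) for each Q ∈ D_{μ,k} and each integer l ≥ 0, μ({x ∈ E∖Q : dist(x,Q) < A₀^{−k−l}} ∪ {x ∈ Q : dist(x, E∖Q) < A₀^{−k−l}}) ≤ A₀^{−γ l} μ(B(x_Q, 90 r(Q))); and (4) writing ℓ(Q) = 56 C₀ A₀^{−k} and B_Q = B(x_Q, 28 r(Q)) for Q ∈ D_{μ,k}, and 2Q = ⋃{P ∈ D_{μ,k} : dist(x_Q, P) ≤ 2 ℓ(Q)}, every Q ∈ D_μ satisfies ∫_{2B_Q∖Q} ( ∫_Q |x−y|^{−n} dμ(y) )² dμ(x) + ∫_Q ( ∫_{2B_Q∖Q} |x−y|^{−n} dμ(y) )² dμ(x) ≤ C(γ,d) Σ_{P ∈ D_μ : P ⊂ 2Q, ℓ(P) ≤ ℓ(Q)} (ℓ(P)/ℓ(Q))^{γ} ( μ(2B_P)/ℓ(P)^n )² μ(P). The constant C(γ,d) does not depend on the growth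 constant c. -/
open MeasureTheory Metric Set ENNReal

noncomputable section

/-- The side length `ℓ(Q) = 56 C₀ A₀^{-k}` of a generation-`k` David–Mattila cube. -/
def sideLength (C₀ A₀ : ℝ) (k : ℤ) : ℝ := 56 * C₀ * A₀ ^ (-k)

/-- Ambient Euclidean space. -/
abbrev EV (d : ℕ) := EuclideanSpace ℝ (Fin d)

theorem dm_isClosed_support {X : Type*} [PseudoMetricSpace X] [MeasurableSpace X]
    (μ : Measure X) : IsClosed (measSupport μ) := by
  rw [← isOpen_compl_iff, Metric.isOpen_iff]
  intro x hx
  simp only [measSupport, mem_compl_iff, mem_ofPred_eq, not_forall, not_lt, nonpos_iff_eq_zero] at hx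
  obtain ⟨r, hr, h0⟩ := hx
  refine ⟨r / 2, by positivity, fun y hy hy' => ?_⟩
  have h1 := hy' (r / 2) (by positivity)
  have h2 : ball y (r / 2) ⊆ ball x r := by
    apply ball_subset_ball'
    have := mem_ball.1 hy
    linarith
  exact absurd (measure_mono_null h2 h0) h1.ne'

theorem dm_support_compl_null {d : ℕ} (μ : Measure (EV d)) : μ (measSupport μ)ᶜ = 0 := by
  apply measure_null_of_locally_null
  intro x hx
  simp only [measSupport, mem_compl_iff, mem_ofPred_eq, not_forall, not_lt, nonpos_iff_eq_zero] at hx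
  obtain ⟨r, hr, h0⟩ := hx
  exact ⟨ball x r, mem_nhdsWithin_of_mem_nhds (ball_mem_nhds x hr), h0⟩

theorem dm_support_subset {d : ℕ} (μ : Measure (EV d)) (K : Set (EV d)) (hK : IsCompact K)
    (h : μ Kᶜ = 0) : measSupport μ ⊆ K := by
  intro x hx
  by_contra hxK
  obtain ⟨r, hr, hb⟩ := Metric.isOpen_iff.1 hK.isClosed.isOpen_compl x hxK
  exact absurd (measure_mono_null hb h) (hx r hr).ne'

/-- Cardinality of separated sets. -/
theorem dm_doubling (d : ℕ) : ∃ D : ℕ, 0 < D ∧ ∀ (r : ℝ), 0 < r → ∀ (x : EV d)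
    (T : Finset (EV d)), (∀ a ∈ T, dist a x < 40 * r) →
    (∀ a ∈ T, ∀ b ∈ T, a ≠ b → 10 * r ≤ dist a b) → T.card ≤ D := by
  obtain ⟨F, hFf, hF⟩ := Metric.totallyBounded_iff.1
    (isCompact_closedBall (0 : EV d) 40).totallyBounded 5 (by norm_num)
  refine ⟨hFf.toFinset.card + 1, by omega, fun r hr x T hT hsep => ?_⟩
  have hmem : ∀ a ∈ T, ∃ y ∈ F, dist (r⁻¹ • (a - x)) y < 5 := by
    intro a ha
    have : r⁻¹ • (a - x) ∈ closedBall (0 : EV d) 40 := by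
      rw [mem_closedBall_zero_iff, norm_smul, ← dist_eq_norm, norm_inv, Real.norm_of_nonneg hr.le,
        inv_mul_le_iff₀ hr]
      have := hT a ha
      linarith
    have := hF this
    simpa using this
  choose! f hf1 hf2 using hmem
  have : T.card ≤ hFf.toFinset.card := by
    apply Finset.card_le_card_of_injOn f
    · intro a ha
      simpa using hf1 a ha
    · intro a ha b hb hab
      by_contra hne
      have h1 := hf2 a ha
      have h2 := hf2 b hb
      rw [hab] at h1
      have h3 : dist (r⁻¹ • (a - x)) (r⁻¹ • (b - x)) < 10 := by
        have := dist_triangle_right (r⁻¹ • (a - x)) (r⁻¹ • (b - x)) (f b)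
        linarith
      rw [dist_smul₀, dist_sub_right, norm_inv, Real.norm_of_nonneg hr.le,
        inv_mul_lt_iff₀ hr] at h3
      have := hsep a ha b hb hne
      linarith
  omega

/-- Bounded overlap. -/
theorem dm_overlap {d D : ℕ} (hD : ∀ (r : ℝ), 0 < r → ∀ (x : EV d)
    (T : Finset (EV d)), (∀ a ∈ T, dist a x < 40 * r) →
    (∀ a ∈ T, ∀ b ∈ T, a ≠ b → 10 * r ≤ dist a b) → T.card ≤ D)
    (ν : Measure (EV d)) (r : ℝ) (hr : 0 < r) (T : Finset (EV d))
    (hsep : ∀ a ∈ T, ∀ b ∈ T, a ≠ b → 10 * r ≤ dist a b) :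
    ∑ a ∈ T, ν (ball a (40 * r)) ≤ D * ν (⋃ a ∈ T, ball a (40 * r)) := by
  classical
  have hm : MeasurableSet (⋃ a ∈ T, ball a (40 * r)) :=
    Finset.measurableSet_biUnion _ fun a _ => measurableSet_ball
  calc ∑ a ∈ T, ν (ball a (40 * r))
      = ∑ a ∈ T, ∫⁻ x, (ball a (40 * r)).indicator 1 x ∂ν := by
        refine Finset.sum_congr rfl fun a _ => ?_
        rw [lintegral_indicator_one measurableSet_ball]
    _ = ∫⁻ x, ∑ a ∈ T, (ball a (40 * r)).indicator 1 x ∂ν := by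
        rw [lintegral_finsetSum]
        intro a _
        exact measurable_one.indicator measurableSet_ball
    _ ≤ ∫⁻ x, D * (⋃ a ∈ T, ball a (40 * r)).indicator 1 x ∂ν := by
        refine lintegral_mono fun x => ?_
        by_cases hx : x ∈ ⋃ a ∈ T, ball a (40 * r)
        · rw [indicator_of_mem hx]
          simp only [indicator_apply, Pi.one_apply, mul_one]
          rw [Finset.sum_boole]
          norm_cast
          apply hD r hr x
          · intro a ha
            have := (Finset.mem_filter.1 ha).2
            rwa [mem_ball, dist_comm] at this
          · intro a ha b hb
            exact hsep a (Finset.mem_filter.1 ha).1 b (Finset.mem_filter.1 hb).1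
        · rw [indicator_of_notMem hx]
          simp only [mul_zero, nonpos_iff_eq_zero]
          refine Finset.sum_eq_zero fun a ha => indicator_of_notMem ?_ _
          intro h
          exact hx (mem_biUnion (s := (T : Set (EV d))) ha h)
    _ = D * ν (⋃ a ∈ T, ball a (40 * r)) := by
        rw [lintegral_const_mul _ (measurable_one.indicator hm), lintegral_indicator_one hm]

/-- Maximal separated finite nets. -/
theorem dm_net {d : ℕ} (E : Set (EV d)) (hE : IsCompact E) (r : ℝ) (hr : 0 < r) :
    ∃ X : Finset (EV d), (∀ a ∈ X, a ∈ E) ∧ (∀ a ∈ X, ∀ b ∈ X, a ≠ b → 10 * r ≤ dist a b) ∧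
      ∀ x ∈ E, ∃ a ∈ X, dist x a < 10 * r := by
  classical
  obtain ⟨F, hFf, hF⟩ := Metric.totallyBounded_iff.1 hE.totallyBounded (5 * r) (by positivity)
  let P : Finset (EV d) → Prop := fun X =>
    (∀ a ∈ X, a ∈ E) ∧ (∀ a ∈ X, ∀ b ∈ X, a ≠ b → 10 * r ≤ dist a b)
  have hbd : ∀ X, P X → X.card ≤ hFf.toFinset.card := by
    rintro X ⟨h1, h2⟩
    have hmem : ∀ a ∈ X, ∃ y ∈ F, dist a y < 5 * r := by
      intro a ha
      simpa using hF (h1 a ha)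
    choose! f hf1 hf2 using hmem
    apply Finset.card_le_card_of_injOn f
    · intro a ha
      simpa using hf1 a ha
    · intro a ha b hb hab
      by_contra hne
      have h3 := hf2 a ha
      have h4 := hf2 b hb
      rw [hab] at h3
      have := dist_triangle_right a b (f b)
      have := h2 a ha b hb hne
      linarith
  obtain ⟨X, hX, hmax⟩ : ∃ X, P X ∧ ∀ Y, P Y → Y.card ≤ X.card := by
    have hb : BddAbove {c | ∃ X, P X ∧ X.card = c} := by
      refine ⟨hFf.toFinset.card, ?_⟩
      rintro c ⟨X, hX, rfl⟩
      exact hbd X hX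
    obtain ⟨X, hX, hc⟩ := Nat.sSup_mem (s := {c | ∃ X, P X ∧ X.card = c})
      ⟨0, ∅, ⟨by simp, by simp⟩, by simp⟩ hb
    refine ⟨X, hX, fun Y hY => ?_⟩
    rw [hc]
    exact le_csSup hb ⟨Y, hY, rfl⟩
  refine ⟨X, hX.1, hX.2, fun x hx => ?_⟩
  by_contra! hcon
  have hxX : x ∉ X := fun h => by
    have := hcon x h
    rw [dist_self] at this
    linarith
  have hP : P (insert x X) := by
    refine ⟨?_, ?_⟩
    · intro a ha
      rcases Finset.mem_insert.1 ha with rfl | ha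
      · exact hx
      · exact hX.1 a ha
    · intro a ha b hb hab
      rcases Finset.mem_insert.1 ha with h1 | h1 <;> rcases Finset.mem_insert.1 hb with h2 | h2
      · exact absurd (h1.trans h2.symm) hab
      · rw [h1]; exact hcon b h2
      · rw [h2, dist_comm]; exact hcon a h1
      · exact hX.2 a h1 b h2 hab
  have h5 := hmax _ hP
  have h6 : (insert x X).card = X.card + 1 := Finset.card_insert_of_notMem hxX
  omega

/-- The annular neighbourhood of the two spheres with parameter `t`. -/
def dmAnn {d : ℕ} (N : ℕ) (r : ℝ) (z : EV d) (t : ℕ) : Set (EV d) :=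
  {x | |dist x z - (3 + t / N) * r| < r / (2 * N) ∨ |dist x z - (11 + t / N) * r| < r / (2 * N)}

theorem dm_measurable_ann {d : ℕ} (N : ℕ) (r : ℝ) (z : EV d) (t : ℕ) :
    MeasurableSet (dmAnn N r z t) := by
  have h : ∀ c : ℝ, MeasurableSet {x : EV d | |dist x z - c| < r / (2 * N)} := fun c =>
    (isOpen_lt (by fun_prop) (by fun_prop)).measurableSet
  exact (h ((3 + t / N) * r)).union (h ((11 + t / N) * r))

theorem dm_ann_disjoint {d : ℕ} (N : ℕ) (hN : 0 < N) (r : ℝ) (hr : 0 < r) (z : EV d) (t t' : ℕ)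
    (ht : t < N) (ht' : t' < N) (hne : t ≠ t') : Disjoint (dmAnn N r z t) (dmAnn N r z t') := by
  wlog h : t < t' generalizing t t'
  · exact (this t' t ht' ht hne.symm (by omega)).symm
  rw [Set.disjoint_left]
  have hN' : (0 : ℝ) < N := by exact_mod_cast hN
  have h1 : (t : ℝ) + 1 ≤ t' := by exact_mod_cast h
  have h2 : (t' : ℝ) + 1 ≤ N := by exact_mod_cast ht'
  have h0 : (0 : ℝ) ≤ t := by positivity
  obtain ⟨u, hu⟩ : ∃ u : ℝ, u = r / N := ⟨_, rfl⟩
  have hu0 : 0 < u := by rw [hu]; positivity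
  have hru : r = N * u := by rw [hu]; field_simp
  have e1 : r / (2 * N) = u / 2 := by rw [hru]; field_simp
  have e2 : ∀ c s : ℝ, (c + s / N) * r = c * r + s * u := by
    intro c s; rw [hru]; field_simp
  rintro x hx hx'
  simp only [dmAnn, mem_ofPred_eq, e1, e2, abs_lt] at hx hx'
  have k1 : (t : ℝ) * u + u ≤ t' * u := by nlinarith
  have k2 : (t' : ℝ) * u + u ≤ r := by rw [hru]; nlinarith
  have k3 : 0 ≤ (t : ℝ) * u := by positivity
  rcases hx with hx | hx <;> rcases hx' with hx' | hx' <;> linarith [hx.1, hx.2, hx'.1, hx'.2]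

theorem dm_ann_subset {d : ℕ} (N : ℕ) (hN : 0 < N) (r : ℝ) (hr : 0 < r) (z : EV d) (t : ℕ)
    (ht : t < N) : dmAnn N r z t ⊆ ball z (13 * r) := by
  intro x hx
  have hN' : (1 : ℝ) ≤ N := by exact_mod_cast hN
  have h1 : (t : ℝ) / N * r ≤ 1 * r := by
    gcongr
    rw [div_le_one (by linarith)]
    exact_mod_cast ht.le
  have h2 : r / (2 * N) ≤ r / 2 := by gcongr; linarith
  simp only [dmAnn, mem_ofPred_eq, abs_lt, add_mul] at hx
  rw [mem_ball]
  rcases hx with hx | hx <;> linarith [hx.1, hx.2]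

/-- Pigeonhole: choose the good radius. -/
theorem dm_pigeon {d : ℕ} (N : ℕ) (hN : 0 < N) (r : ℝ) (hr : 0 < r) (z : EV d)
    (μ ν : Measure (EV d)) :
    ∃ t < N, μ (dmAnn N r z t) ≤ (2 / N) * μ (ball z (13 * r)) ∧
      ν (dmAnn N r z t) ≤ (2 / N) * ν (ball z (13 * r)) := by
  have key : ∀ ρ : Measure (EV d), ∑ t ∈ Finset.range N,
      ρ (dmAnn N r z t) / ρ (ball z (13 * r)) ≤ 1 := by
    intro ρ
    simp only [div_eq_mul_inv]
    rw [← Finset.sum_mul, ← measure_biUnion_finset]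
    · calc _ ≤ ρ (ball z (13 * r)) * (ρ (ball z (13 * r)))⁻¹ := by
            gcongr
            refine iUnion₂_subset fun t ht => dm_ann_subset N hN r hr z t (Finset.mem_range.1 ht)
        _ ≤ 1 := ENNReal.mul_inv_le_one _
    · intro t ht t' ht' hne
      exact dm_ann_disjoint N hN r hr z t t' (by simpa using ht) (by simpa using ht') hne
    · intro t _
      exact dm_measurable_ann N r z t
  have h2 : ∑ t ∈ Finset.range N, (μ (dmAnn N r z t) / μ (ball z (13 * r)) +
      ν (dmAnn N r z t) / ν (ball z (13 * r))) ≤ ∑ t ∈ Finset.range N, (2 / N : ℝ≥0∞) := by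
    rw [Finset.sum_add_distrib, Finset.sum_const, Finset.card_range, nsmul_eq_mul,
      ENNReal.mul_div_cancel (by exact_mod_cast hN.ne') (by simp)]
    calc _ ≤ (1 : ℝ≥0∞) + 1 := add_le_add (key μ) (key ν)
      _ = 2 := by norm_num
  obtain ⟨t, ht, hle⟩ : ∃ t ∈ Finset.range N, (μ (dmAnn N r z t) / μ (ball z (13 * r)) +
      ν (dmAnn N r z t) / ν (ball z (13 * r))) ≤ (2 / N : ℝ≥0∞) := by
    by_contra! hcon
    exact absurd h2 (not_le.2 (ENNReal.sum_lt_sum_of_nonempty (by simpa using hN.ne') hcon))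
  have ht' := Finset.mem_range.1 ht
  have fin : ∀ ρ : Measure (EV d), ρ (dmAnn N r z t) / ρ (ball z (13 * r)) ≤ 2 / N →
      ρ (dmAnn N r z t) ≤ (2 / N) * ρ (ball z (13 * r)) := by
    intro ρ h
    rcases eq_or_ne (ρ (ball z (13 * r))) 0 with h0 | h0
    · rw [measure_mono_null (dm_ann_subset N hN r hr z t ht') h0]; simp
    · rwa [ENNReal.div_le_iff_le_mul (Or.inl h0) (Or.inr ?_)] at h
      refine ENNReal.div_ne_zero.2 ⟨by simp, by simp⟩
  exact ⟨t, ht', fin μ (le_trans le_self_add hle), fin ν (le_trans le_add_self hle)⟩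

/-- Nets with shaken radii, at all scales. -/
structure DMNet (d : ℕ) where
  E : Set (EV d)
  N : ℕ
  r : ℕ → ℝ
  X : ℕ → Finset (EV d)
  t : ℕ → EV d → ℕ
  hE : IsClosed E
  hN : 0 < N
  r_pos : ∀ i, 0 < r i
  r_succ : ∀ i, r i = 150 * N * r (i + 1)
  XE : ∀ i, ∀ a ∈ X i, a ∈ E
  sep : ∀ i, ∀ a ∈ X i, ∀ b ∈ X i, a ≠ b → 10 * r i ≤ dist a b
  cov : ∀ i, ∀ x ∈ E, ∃ a ∈ X i, dist x a < 10 * r i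
  t_lt : ∀ i, ∀ a ∈ X i, t i a < N

namespace DMNet

variable {d : ℕ} (S : DMNet d)

/-- Core radius. -/
def core (i : ℕ) (z : EV d) : ℝ := (3 + S.t i z / S.N) * S.r i

/-- Outer radius. -/
def outer (i : ℕ) (z : EV d) : ℝ := (11 + S.t i z / S.N) * S.r i

theorem r_small (i : ℕ) : 150 * S.r (i + 1) ≤ S.r i := by
  rw [S.r_succ i]
  have h1 : (1 : ℝ) ≤ S.N := by exact_mod_cast S.hN
  have := S.r_pos (i + 1)
  nlinarith

theorem frac_bd (i : ℕ) (z : EV d) (hz : z ∈ S.X i) :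
    0 ≤ (S.t i z : ℝ) / S.N * S.r i ∧ (S.t i z : ℝ) / S.N * S.r i < S.r i := by
  have h1 : (0 : ℝ) < S.N := by exact_mod_cast S.hN
  have := S.r_pos i
  refine ⟨by positivity, ?_⟩
  have h2 : (S.t i z : ℝ) / S.N < 1 := by
    rw [div_lt_one h1]
    exact_mod_cast S.t_lt i z hz
  nlinarith

theorem core_bd (i : ℕ) (z : EV d) (hz : z ∈ S.X i) :
    3 * S.r i ≤ S.core i z ∧ S.core i z < 4 * S.r i := by
  have := S.frac_bd i z hz
  unfold core
  rw [add_mul]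
  constructor <;> linarith

theorem outer_bd (i : ℕ) (z : EV d) (hz : z ∈ S.X i) :
    11 * S.r i ≤ S.outer i z ∧ S.outer i z < 12 * S.r i := by
  have := S.frac_bd i z hz
  unfold outer
  rw [add_mul]
  constructor <;> linarith

/-- Admissible centres for a point. -/
def adm (i : ℕ) (x z : EV d) : Prop :=
  dist x z < S.core i z ∨ ((∀ w ∈ S.X i, ¬ dist x w < S.core i w) ∧ dist x z < S.outer i z)

/-- Unnested labelling. -/
def Phi (i : ℕ) (x : EV d) : EV d := Classical.epsilon fun z => z ∈ S.X i ∧ S.adm i x z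

theorem Phi_spec (i : ℕ) (x : EV d) (hx : x ∈ S.E) :
    S.Phi i x ∈ S.X i ∧ S.adm i x (S.Phi i x) := by
  apply Classical.epsilon_spec (p := fun z => z ∈ S.X i ∧ S.adm i x z)
  by_cases h : ∃ w ∈ S.X i, dist x w < S.core i w
  · obtain ⟨w, hw, h⟩ := h
    exact ⟨w, hw, Or.inl h⟩
  · push Not at h
    obtain ⟨a, ha, hxa⟩ := S.cov i x hx
    have := (S.outer_bd i a ha).1
    have := S.r_pos i
    exact ⟨a, ha, Or.inr ⟨fun w hw => not_lt.2 (h w hw), by linarith⟩⟩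

theorem Phi_mem (i : ℕ) (x : EV d) (hx : x ∈ S.E) : S.Phi i x ∈ S.X i := (S.Phi_spec i x hx).1

theorem Phi_dist (i : ℕ) (x : EV d) (hx : x ∈ S.E) : dist x (S.Phi i x) < 12 * S.r i := by
  obtain ⟨h1, h2⟩ := S.Phi_spec i x hx
  have := (S.outer_bd i _ h1).2
  have := (S.core_bd i _ h1).2
  have := S.r_pos i
  rcases h2 with h2 | ⟨-, h2⟩ <;> linarith

theorem Phi_core (i : ℕ) (x z : EV d) (hx : x ∈ S.E) (hz : z ∈ S.X i)
    (h : dist x z < 3 * S.r i) : S.Phi i x = z := by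
  obtain ⟨h1, h2⟩ := S.Phi_spec i x hx
  have h3 := (S.core_bd i _ h1).2
  have h4 := S.core_bd i _ hz
  have := S.r_pos i
  rcases h2 with h2 | ⟨h2, -⟩
  · by_contra hne
    have h5 := S.sep i _ h1 _ hz hne
    have := dist_triangle_left (S.Phi i x) z x
    linarith
  · exact absurd (by linarith) (h2 z hz)

theorem Phi_ne (i : ℕ) (x y : EV d) (δ : ℝ) (hxy : dist x y < δ)
    (h : S.Phi i x ≠ S.Phi i y) :
    ∃ j ∈ S.X i, |dist x j - S.core i j| < δ ∨ |dist x j - S.outer i j| < δ := by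
  by_contra! hcon
  have key : ∀ (x' y' : EV d) (ρ : ℝ) (j : EV d), dist x' j < ρ → ¬ dist y' j < ρ →
      |dist x' j - ρ| ≤ dist x' y' ∧ |dist y' j - ρ| ≤ dist x' y' := by
    intro x' y' ρ j h1 h2
    have h3 := dist_triangle_left y' j x'
    constructor <;> rw [abs_le] <;> constructor <;> linarith [dist_nonneg (x := x') (y := y')]
  have key2 : ∀ j ρ, δ ≤ |dist x j - ρ| → (dist x j < ρ ↔ dist y j < ρ) := by
    intro j ρ hδ
    constructor
    · intro h1
      by_contra h2
      have := (key x y ρ j h1 h2).1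
      linarith
    · intro h1
      by_contra h2
      have := (key y x ρ j h1 h2).2
      rw [dist_comm y x] at this
      linarith
  apply h
  unfold Phi
  congr 1
  funext z
  rw [eq_iff_iff, and_congr_right_iff]
  intro hz
  unfold adm
  have e1 : ∀ w ∈ S.X i, (dist x w < S.core i w ↔ dist y w < S.core i w) :=
    fun w hw => key2 w _ (hcon w hw).1
  have e2 := key2 z _ (hcon z hz).2
  rw [e1 z hz, e2]
  have : (∀ w ∈ S.X i, ¬ dist x w < S.core i w) ↔ (∀ w ∈ S.X i, ¬ dist y w < S.core i w) :=
    forall₂_congr fun w hw => not_congr (e1 w hw)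
  rw [this]

end DMNet

theorem dm_measurable_pick {d : ℕ} (X : Finset (EV d)) (p : EV d → EV d → Prop)
    (hp : ∀ z ∈ X, MeasurableSet {x | p x z}) :
    Measurable fun x => Classical.epsilon fun z => z ∈ X ∧ p x z := by
  classical
  let T : EV d → (X → Prop) := fun x z => p x z
  let g : (X → Prop) → EV d := fun τ => Classical.epsilon fun z => ∃ h : z ∈ X, τ ⟨z, h⟩
  have hT : Measurable T := by
    rw [measurable_pi_iff]
    intro z
    exact measurableSet_setOfPred.1 (hp z z.2)
  have hg : Measurable g := measurable_of_finite g
  have : (fun x => Classical.epsilon fun z => z ∈ X ∧ p x z) = g ∘ T := by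
    funext x
    simp only [g, T, Function.comp]
    congr 1
    funext z
    simp
  rw [this]
  exact hg.comp hT

namespace DMNet

variable {d : ℕ} (S : DMNet d)

theorem measurable_Phi (i : ℕ) : Measurable (S.Phi i) := by
  apply dm_measurable_pick
  intro z hz
  have h : ∀ w ρ, MeasurableSet {x : EV d | dist x w < ρ} := fun w ρ =>
    measurableSet_ball
  have h2 : MeasurableSet {x : EV d | ∀ w ∈ S.X i, ¬ dist x w < S.core i w} := by
    have : {x : EV d | ∀ w ∈ S.X i, ¬ dist x w < S.core i w}
        = ⋂ w ∈ S.X i, {x : EV d | dist x w < S.core i w}ᶜ := by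
      ext x; simp
    rw [this]
    exact Finset.measurableSet_biInter _ fun w _ => (h w _).compl
  exact (h z _).union (h2.inter (h z _))

/-- Iterated labels. -/
def G : ℕ → ℕ → EV d → EV d
  | i, 0, x => S.Phi i x
  | i, (m + 1), x => S.Phi i (G (i + 1) m x)

theorem measurable_G (m : ℕ) : ∀ i, Measurable (S.G i m) := by
  induction m with
  | zero => intro i; exact S.measurable_Phi i
  | succ m ih => intro i; exact (S.measurable_Phi i).comp (ih (i + 1))

theorem G_mem (m : ℕ) : ∀ i, ∀ x ∈ S.E, S.G i m x ∈ S.X i := by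
  induction m with
  | zero => intro i x hx; exact S.Phi_mem i x hx
  | succ m ih => intro i x hx; exact S.Phi_mem i _ (S.XE _ _ (ih (i + 1) x hx))

theorem G_dist (m : ℕ) : ∀ i, ∀ x ∈ S.E, dist x (S.G i m x) < 13 * S.r i := by
  induction m with
  | zero =>
    intro i x hx
    have := S.Phi_dist i x hx
    have := S.r_pos i
    simp only [G]
    linarith
  | succ m ih =>
    intro i x hx
    have h1 := ih (i + 1) x hx
    have h2 := S.Phi_dist i _ (S.XE _ _ (S.G_mem m (i + 1) x hx))
    have h3 := dist_triangle x (S.G (i + 1) m x) (S.Phi i (S.G (i + 1) m x))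
    have := S.r_small i
    have := S.r_pos i
    simp only [G]
    linarith

/-- Possible limit labels. -/
def Cset (i : ℕ) (z : EV d) : Set (EV d) := {x | ∃ᶠ m in Filter.atTop, S.G i m x = z}

theorem measurable_Cset (i : ℕ) (z : EV d) : MeasurableSet (S.Cset i z) := by
  have : S.Cset i z = ⋂ a : ℕ, ⋃ b : ℕ, ⋃ _ : a ≤ b, (S.G i b) ⁻¹' {z} := by
    ext x
    simp [Cset, Filter.frequently_atTop]
  rw [this]
  exact MeasurableSet.iInter fun a => MeasurableSet.iUnion fun b => MeasurableSet.iUnion fun _ =>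
    S.measurable_G b i (measurableSet_singleton z)

theorem freq_pigeon (X : Finset (EV d)) (f : ℕ → EV d) (p : EV d → Prop)
    (h : ∃ᶠ m in Filter.atTop, p (f m)) (hf : ∀ m, f m ∈ X) :
    ∃ z ∈ X, p z ∧ ∃ᶠ m in Filter.atTop, f m = z := by
  by_contra! hcon
  have h1 : ∀ z ∈ X, ∀ᶠ m in Filter.atTop, p z → f m ≠ z := by
    intro z hz
    by_cases hp : p z
    · have := hcon z hz hp
      filter_upwards [this] with m hm _ using hm
    · exact Filter.Eventually.of_forall fun m h => absurd h hp
  have h2 := (Filter.eventually_all_finset X).2 h1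
  obtain ⟨m, hm, hm2⟩ := (h.and_eventually h2).exists
  exact hm2 (f m) (hf m) hm rfl

theorem exists_top (i : ℕ) (x : EV d) (hx : x ∈ S.E) : ∃ z ∈ S.X i, x ∈ S.Cset i z := by
  obtain ⟨z, hz, -, h⟩ := freq_pigeon (S.X i) (fun m => S.G i m x) (fun _ => True)
    (Filter.Frequently.of_forall fun _ => trivial) (fun m => S.G_mem m i x hx)
  exact ⟨z, hz, h⟩

theorem exists_child (i : ℕ) (x z : EV d) (hx : x ∈ S.E) (h : x ∈ S.Cset i z) :
    ∃ v ∈ S.X (i + 1), S.Phi i v = z ∧ x ∈ S.Cset (i + 1) v := by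
  have h' : ∃ᶠ m in Filter.atTop, S.G i m x = z := h
  have h1 : ∃ᶠ m in Filter.atTop, S.G i (m + 1) x = z := by
    rw [Filter.frequently_atTop] at h' ⊢
    intro a
    obtain ⟨b, hb, hb2⟩ := h' (a + 1)
    refine ⟨b - 1, by omega, ?_⟩
    rwa [Nat.sub_add_cancel (by omega)]
  exact freq_pigeon (S.X (i + 1)) (fun m => S.G (i + 1) m x) (fun v => S.Phi i v = z) h1
    (fun m => S.G_mem m (i + 1) x hx)

theorem Cset_dist (i : ℕ) (x z : EV d) (hx : x ∈ S.E) (h : x ∈ S.Cset i z) :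
    dist x z < 13 * S.r i := by
  have h' : ∃ᶠ m in Filter.atTop, S.G i m x = z := h
  obtain ⟨m, hm⟩ := h'.exists
  rw [← hm]
  exact S.G_dist m i x hx

/-- Nested labels. -/
def L : ℕ → EV d → EV d
  | 0, x => Classical.epsilon fun z => z ∈ S.X 0 ∧ x ∈ S.Cset 0 z
  | (i + 1), x => Classical.epsilon fun z => z ∈ S.X (i + 1) ∧
      (S.Phi i z = L i x ∧ x ∈ S.Cset (i + 1) z)

theorem measurable_L (i : ℕ) : Measurable (S.L i) := by
  induction i with
  | zero => exact dm_measurable_pick _ _ fun z _ => S.measurable_Cset 0 z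
  | succ i ih =>
    refine dm_measurable_pick _ _ fun z _ => ?_
    have : MeasurableSet {x | S.Phi i z = S.L i x} := by
      have := ih (measurableSet_singleton (S.Phi i z))
      convert this using 1
      ext x
      simp [eq_comm]
    exact this.inter (S.measurable_Cset (i + 1) z)

theorem L_spec (i : ℕ) (x : EV d) (hx : x ∈ S.E) : S.L i x ∈ S.X i ∧ x ∈ S.Cset i (S.L i x) := by
  induction i with
  | zero => exact Classical.epsilon_spec (S.exists_top 0 x hx)
  | succ i ih =>
    have := Classical.epsilon_spec (S.exists_child i x _ hx ih.2)
    exact ⟨this.1, this.2.2⟩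

theorem L_succ (i : ℕ) (x : EV d) (hx : x ∈ S.E) : S.Phi i (S.L (i + 1) x) = S.L i x :=
  (Classical.epsilon_spec (S.exists_child i x _ hx (S.L_spec i x hx).2)).2.1

theorem L_mem (i : ℕ) (x : EV d) (hx : x ∈ S.E) : S.L i x ∈ S.X i := (S.L_spec i x hx).1

theorem L_dist (i : ℕ) (x : EV d) (hx : x ∈ S.E) : dist x (S.L i x) < 13 * S.r i :=
  S.Cset_dist i x _ hx (S.L_spec i x hx).2

theorem L_core (i : ℕ) (x z : EV d) (hx : x ∈ S.E) (hz : z ∈ S.X i)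
    (h : dist x z < S.r i) : S.L i x = z := by
  rw [← S.L_succ i x hx]
  apply S.Phi_core i _ z (S.XE _ _ (S.L_mem (i + 1) x hx)) hz
  have h1 := S.L_dist (i + 1) x hx
  have h2 := S.r_small i
  have h3 := dist_triangle_left (S.L (i + 1) x) z x
  have := S.r_pos i
  linarith

theorem L_nest (i m : ℕ) (x y : EV d) (hx : x ∈ S.E) (hy : y ∈ S.E)
    (h : S.L (i + m) x = S.L (i + m) y) : S.L i x = S.L i y := by
  induction m with
  | zero => exact h
  | succ m ih =>
    apply ih
    rw [← S.L_succ (i + m) x hx, ← S.L_succ (i + m) y hy]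
    exact congrArg _ h

/-- The cubes. -/
def Q (i : ℕ) (z : EV d) : Set (EV d) := {x | x ∈ S.E ∧ S.L i x = z}

theorem measurable_Q (i : ℕ) (z : EV d) : MeasurableSet (S.Q i z) :=
  S.hE.measurableSet.inter (S.measurable_L i (measurableSet_singleton z))

/-- Boundary layers. -/
def Nb (i m : ℕ) (z : EV d) : Set (EV d) :=
  {x | x ∈ S.E ∧ ∃ y ∈ S.E, dist x y < S.r (i + m) ∧
    ((S.L i x = z ∧ S.L i y ≠ z) ∨ (S.L i x ≠ z ∧ S.L i y = z))}

theorem measurable_Nb (i m : ℕ) (z : EV d) : MeasurableSet (S.Nb i m z) := by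
  have : S.Nb i m z = (S.Q i z ∩ thickening (S.r (i + m)) (S.E \ S.Q i z)) ∪
      ((S.E \ S.Q i z) ∩ thickening (S.r (i + m)) (S.Q i z)) := by
    ext x
    simp only [Nb, Q, mem_ofPred_eq, mem_union, mem_inter_iff, mem_sdiff, mem_thickening_iff]
    grind
  rw [this]
  have h1 := S.measurable_Q i z
  have h2 := S.hE.measurableSet.diff h1
  exact (h1.inter isOpen_thickening.measurableSet).union
    (h2.inter isOpen_thickening.measurableSet)

/-- The relevant boundary subcubes. -/
def Gs (i : ℕ) (z : EV d) : Finset (EV d) := by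
  classical
  exact (S.X (i + 1)).filter fun a => ∃ b, dist a b < 27 * S.r (i + 1) ∧
    ((S.Phi i a = z ∧ S.Phi i b ≠ z) ∨ (S.Phi i a ≠ z ∧ S.Phi i b = z)) ∧ b ∈ S.E

theorem mem_Gs (i : ℕ) (z a : EV d) : a ∈ S.Gs i z ↔ a ∈ S.X (i + 1) ∧
    ∃ b, dist a b < 27 * S.r (i + 1) ∧
    ((S.Phi i a = z ∧ S.Phi i b ≠ z) ∨ (S.Phi i a ≠ z ∧ S.Phi i b = z)) ∧ b ∈ S.E := by
  classical
  simp [Gs]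

theorem r_anti (i m : ℕ) : S.r (i + m) ≤ S.r i := by
  induction m with
  | zero => simp
  | succ m ih =>
    have := S.r_small (i + m)
    have := S.r_pos (i + m + 1)
    have e : i + (m + 1) = i + m + 1 := rfl
    rw [e]
    linarith

theorem Nb_succ (i m : ℕ) (z : EV d) :
    S.Nb i (m + 1) z ⊆ ⋃ a ∈ S.Gs i z, S.Nb (i + 1) m a := by
  rintro x ⟨hx, y, hy, hxy, h⟩
  have e : i + (m + 1) = i + 1 + m := by omega
  rw [e] at hxy
  have hne : S.L i x ≠ S.L i y := by grind
  simp only [mem_iUnion, exists_prop]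
  refine ⟨S.L (i + 1) x, ?_, hx, y, hy, hxy, Or.inl ⟨rfl, ?_⟩⟩
  · rw [S.mem_Gs]
    refine ⟨S.L_mem _ x hx, S.L (i + 1) y, ?_, ?_, S.XE _ _ (S.L_mem _ y hy)⟩
    · have h1 := S.L_dist (i + 1) x hx
      have h2 := S.L_dist (i + 1) y hy
      have h3 := S.r_anti (i + 1) m
      have h4 := dist_triangle4 (S.L (i + 1) x) x y (S.L (i + 1) y)
      rw [dist_comm (S.L (i + 1) x) x] at h4
      linarith
    · rw [S.L_succ i x hx, S.L_succ i y hy]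
      exact h
  · intro h5
    exact hne (S.L_nest i 1 x y hx hy h5.symm)

theorem Nb_subset (i m : ℕ) (z : EV d) : S.Nb i m z ⊆ ball z (40 * S.r i) := by
  rintro x ⟨hx, y, hy, hxy, h⟩
  have h1 := S.L_dist i x hx
  have h2 := S.L_dist i y hy
  have h3 := S.r_anti i m
  have := S.r_pos i
  rw [mem_ball]
  rcases h with h | h
  · rw [h.1] at h1; linarith
  · rw [h.2] at h2
    have := dist_triangle x y z
    linarith

/-- The key geometric step. -/
theorem Gs_sum {D : ℕ} (hD : ∀ (r : ℝ), 0 < r → ∀ (x : EV d)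
    (T : Finset (EV d)), (∀ a ∈ T, dist a x < 40 * r) →
    (∀ a ∈ T, ∀ b ∈ T, a ≠ b → 10 * r ≤ dist a b) → T.card ≤ D)
    (ν : Measure (EV d)) (i : ℕ)
    (hν : ∀ j ∈ S.X i, ν (dmAnn S.N (S.r i) j (S.t i j)) ≤ (2 / S.N) * ν (ball j (13 * S.r i)))
    (z : EV d) :
    ∑ a ∈ S.Gs i z, ν (ball a (40 * S.r (i + 1))) ≤
      (D * (D * (2 / S.N))) * ν (ball z (40 * S.r i)) := by
  classical
  have hri := S.r_pos i
  have hri1 := S.r_pos (i + 1)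
  have hrs := S.r_small i
  set J := (S.X i).filter fun j => dist j z < 27 * S.r i with hJ
  have hw : S.r i / (2 * S.N) = 75 * S.r (i + 1) := by
    have h1 : (S.N : ℝ) ≠ 0 := by exact_mod_cast S.hN.ne'
    rw [S.r_succ i]; field_simp; norm_num
  have hsub : (⋃ a ∈ S.Gs i z, ball a (40 * S.r (i + 1))) ⊆
      ⋃ j ∈ J, dmAnn S.N (S.r i) j (S.t i j) := by
    intro x hx
    simp only [mem_iUnion, exists_prop] at hx ⊢
    obtain ⟨a, ha, hxa⟩ := hx
    rw [mem_ball] at hxa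
    obtain ⟨haX, b, hab, hPhi, hbE⟩ := (S.mem_Gs i z a).1 ha
    have haE := S.XE _ _ haX
    obtain ⟨j, hj, hj2⟩ := S.Phi_ne i a b _ hab (by grind)
    have hc := S.core_bd i j hj
    have ho := S.outer_bd i j hj
    have hPa := S.Phi_dist i a haE
    have hPb := S.Phi_dist i b hbE
    have haz : dist a z < 13 * S.r i := by
      rcases hPhi with h | h
      · rw [h.1] at hPa; linarith
      · rw [h.2] at hPb
        have := dist_triangle a b z
        linarith
    have haj : dist a j < 13 * S.r i := by
      rcases hj2 with h | h <;> rw [abs_lt] at h <;> linarith [h.1, h.2]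
    refine ⟨j, ?_, ?_⟩
    · rw [hJ, Finset.mem_filter]
      refine ⟨hj, ?_⟩
      have := dist_triangle_left j z a
      linarith
    · have h1 := dist_triangle x a j
      have h2 := dist_triangle_left a j x
      simp only [dmAnn, mem_ofPred_eq, hw]
      rcases hj2 with h | h
      · left
        change |dist x j - S.core i j| < _
        rw [abs_lt] at h ⊢
        constructor <;> linarith [h.1, h.2]
      · right
        change |dist x j - S.outer i j| < _
        rw [abs_lt] at h ⊢
        constructor <;> linarith [h.1, h.2]
  have hJcard : J.card ≤ D := by
    apply hD (S.r i) hri z J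
    · intro a ha
      have := (Finset.mem_filter.1 ha).2
      linarith
    · intro a ha b hb
      exact S.sep i a (Finset.mem_filter.1 ha).1 b (Finset.mem_filter.1 hb).1
  calc ∑ a ∈ S.Gs i z, ν (ball a (40 * S.r (i + 1)))
      ≤ D * ν (⋃ a ∈ S.Gs i z, ball a (40 * S.r (i + 1))) := by
        apply dm_overlap hD ν _ hri1
        intro a ha b hb
        exact S.sep (i + 1) a ((S.mem_Gs i z a).1 ha).1 b ((S.mem_Gs i z b).1 hb).1
    _ ≤ D * ν (⋃ j ∈ J, dmAnn S.N (S.r i) j (S.t i j)) := by gcongr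
    _ ≤ D * ∑ j ∈ J, ν (dmAnn S.N (S.r i) j (S.t i j)) := by
        gcongr
        exact measure_biUnion_finset_le _ _
    _ ≤ D * ∑ j ∈ J, (2 / S.N) * ν (ball z (40 * S.r i)) := by
        gcongr with j hj
        refine (hν j (Finset.mem_filter.1 hj).1).trans ?_
        gcongr
        apply ball_subset_ball'
        have := (Finset.mem_filter.1 hj).2
        linarith
    _ = D * (J.card * ((2 / S.N) * ν (ball z (40 * S.r i)))) := by
        rw [Finset.sum_const, nsmul_eq_mul]
    _ ≤ D * (D * ((2 / S.N) * ν (ball z (40 * S.r i)))) := by gcongr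
    _ = _ := by ring

theorem mu_Nb {q : ℝ≥0∞} (μ : Measure (EV d))
    (hq : ∀ i z, ∑ a ∈ S.Gs i z, μ (ball a (40 * S.r (i + 1))) ≤ q * μ (ball z (40 * S.r i)))
    (m : ℕ) : ∀ i z, μ (S.Nb i m z) ≤ q ^ m * μ (ball z (40 * S.r i)) := by
  induction m with
  | zero => intro i z; simpa using measure_mono (S.Nb_subset i 0 z)
  | succ m ih =>
    intro i z
    calc μ (S.Nb i (m + 1) z) ≤ μ (⋃ a ∈ S.Gs i z, S.Nb (i + 1) m a) :=
          measure_mono (S.Nb_succ i m z)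
      _ ≤ ∑ a ∈ S.Gs i z, μ (S.Nb (i + 1) m a) := measure_biUnion_finset_le _ _
      _ ≤ ∑ a ∈ S.Gs i z, q ^ m * μ (ball a (40 * S.r (i + 1))) :=
          Finset.sum_le_sum fun a _ => ih (i + 1) a
      _ ≤ q ^ m * (q * μ (ball z (40 * S.r i))) := by
          rw [← Finset.mul_sum]
          gcongr
          exact hq i z
      _ = _ := by ring

/-- Energy version. -/
theorem energy_Nb {q g b : ℝ≥0∞} (σ ν : ℕ → Measure (EV d))
    (hσν : ∀ i s, σ i s ≤ ν i s) (hνν : ∀ i s, g * ν (i + 1) s ≤ ν i s)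
    (hg0 : g ≠ 0) (hgt : g ≠ ∞)
    (hbq : 2 * b ^ 2 * q ≤ g)
    (hq : ∀ i z, ∑ a ∈ S.Gs i z, ν i (ball a (40 * S.r (i + 1))) ≤
      q * ν i (ball z (40 * S.r i)))
    (M : ℕ) : ∀ i z, ∑ m ∈ Finset.range M, (b ^ 2) ^ m * σ (i + m) (S.Nb i m z) ≤
      2 * ν i (ball z (40 * S.r i)) := by
  have hνν' : ∀ i s, ν (i + 1) s ≤ g⁻¹ * ν i s := by
    intro i s
    calc ν (i + 1) s = g⁻¹ * (g * ν (i + 1) s) := by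
          rw [← mul_assoc, ENNReal.inv_mul_cancel hg0 hgt, one_mul]
      _ ≤ _ := by gcongr; exact hνν i s
  induction M with
  | zero => intro i z; simp
  | succ M ih =>
    intro i z
    rw [Finset.sum_range_succ']
    have h0 : (b ^ 2) ^ 0 * σ (i + 0) (S.Nb i 0 z) ≤ ν i (ball z (40 * S.r i)) := by
      rw [pow_zero, one_mul, add_zero]
      exact (hσν i _).trans (measure_mono (S.Nb_subset i 0 z))
    have h1 : ∑ m ∈ Finset.range M, (b ^ 2) ^ (m + 1) * σ (i + (m + 1)) (S.Nb i (m + 1) z) ≤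
        ν i (ball z (40 * S.r i)) := by
      calc ∑ m ∈ Finset.range M, (b ^ 2) ^ (m + 1) * σ (i + (m + 1)) (S.Nb i (m + 1) z)
          ≤ ∑ m ∈ Finset.range M, (b ^ 2) ^ (m + 1) *
              ∑ a ∈ S.Gs i z, σ (i + 1 + m) (S.Nb (i + 1) m a) := by
            refine Finset.sum_le_sum fun m _ => ?_
            gcongr
            rw [show i + (m + 1) = i + 1 + m by omega]
            exact (measure_mono (S.Nb_succ i m z)).trans (measure_biUnion_finset_le _ _)
        _ = ∑ a ∈ S.Gs i z, b ^ 2 * ∑ m ∈ Finset.range M,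
              (b ^ 2) ^ m * σ (i + 1 + m) (S.Nb (i + 1) m a) := by
            simp_rw [Finset.mul_sum]
            rw [Finset.sum_comm]
            refine Finset.sum_congr rfl fun a _ => Finset.sum_congr rfl fun m _ => ?_
            ring
        _ ≤ ∑ a ∈ S.Gs i z, b ^ 2 * (2 * (g⁻¹ * ν i (ball a (40 * S.r (i + 1))))) := by
            refine Finset.sum_le_sum fun a _ => ?_
            gcongr
            refine (ih (i + 1) a).trans ?_
            gcongr
            exact hνν' i _
        _ = (2 * b ^ 2 * g⁻¹) * ∑ a ∈ S.Gs i z, ν i (ball a (40 * S.r (i + 1))) := by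
            rw [Finset.mul_sum]
            refine Finset.sum_congr rfl fun a _ => ?_
            ring
        _ ≤ (2 * b ^ 2 * g⁻¹) * (q * ν i (ball z (40 * S.r i))) := by
            gcongr
            exact hq i z
        _ = (2 * b ^ 2 * q) * g⁻¹ * ν i (ball z (40 * S.r i)) := by ring
        _ ≤ g * g⁻¹ * ν i (ball z (40 * S.r i)) := by gcongr
        _ = ν i (ball z (40 * S.r i)) := by rw [ENNReal.mul_inv_cancel hg0 hgt, one_mul]
    rw [two_mul]
    exact add_le_add h1 h0

end DMNet

/-- Density at scale `i`. -/
def dmTheta {d : ℕ} (μ : Measure (EV d)) (n : ℕ) (r : ℕ → ℝ) (i : ℕ) (x : EV d) : ℝ≥0∞ :=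
  μ (ball x (r i)) / ENNReal.ofReal (r i ^ n)

/-- Energy measure at scale `i`. -/
def dmSigma {d : ℕ} (μ : Measure (EV d)) (n : ℕ) (r : ℕ → ℝ) (i : ℕ) : Measure (EV d) :=
  μ.withDensity fun x => dmTheta μ n r i x ^ 2

/-- Combined energy measure. -/
def dmNu {d : ℕ} (μ : Measure (EV d)) (n : ℕ) (r : ℕ → ℝ) (g : ℝ≥0∞) (i : ℕ) :
    Measure (EV d) :=
  Measure.sum fun m : ℕ => g ^ m • dmSigma μ n r (i + m)

theorem dm_measurable_theta {d : ℕ} (μ : Measure (EV d)) [IsFiniteMeasure μ] (n : ℕ) (r : ℕ → ℝ)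
    (i : ℕ) : Measurable (dmTheta μ n r i) := by
  have h : MeasurableSet {p : EV d × EV d | dist p.2 p.1 < r i} :=
    (isOpen_lt (by fun_prop) (by fun_prop)).measurableSet
  exact (measurable_measure_prodMk_left (ν := μ) h).div_const _

theorem dm_nu_apply {d : ℕ} (μ : Measure (EV d)) (n : ℕ) (r : ℕ → ℝ) (g : ℝ≥0∞) (i : ℕ)
    (s : Set (EV d)) (hs : MeasurableSet s) :
    dmNu μ n r g i s = ∑' m, g ^ m * dmSigma μ n r (i + m) s := by
  rw [dmNu, Measure.sum_apply _ hs]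
  rfl

theorem dm_sigma_le_nu {d : ℕ} (μ : Measure (EV d)) (n : ℕ) (r : ℕ → ℝ) (g : ℝ≥0∞) (i : ℕ)
    (s : Set (EV d)) : dmSigma μ n r i s ≤ dmNu μ n r g i s := by
  have h := Measure.le_sum (fun m : ℕ => g ^ m • dmSigma μ n r (i + m)) 0
  have := h s
  simpa [dmNu] using this

theorem dm_nu_succ {d : ℕ} (μ : Measure (EV d)) (n : ℕ) (r : ℕ → ℝ) (g : ℝ≥0∞) (i : ℕ)
    (s : Set (EV d)) : g * dmNu μ n r g (i + 1) s ≤ dmNu μ n r g i s := by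
  have h : g • dmNu μ n r g (i + 1) ≤ dmNu μ n r g i := by
    rw [Measure.le_iff]
    intro s hs
    rw [Measure.smul_apply, smul_eq_mul, dm_nu_apply _ _ _ _ _ _ hs, dm_nu_apply _ _ _ _ _ _ hs,
      ← ENNReal.tsum_mul_left]
    calc _ = ∑' m, (fun m => g ^ m * dmSigma μ n r (i + m) s) (m + 1) := by
          refine tsum_congr fun m => ?_
          simp only
          rw [show i + (m + 1) = i + 1 + m by omega]
          ring
      _ ≤ _ := ENNReal.tsum_comp_le_tsum_of_injective (add_left_injective 1) _
  exact h s

theorem dm_tsum_sq (f : ℕ → ℝ≥0∞) (b : ℝ≥0∞) (hb : 2 ≤ b) (hbt : b ≠ ∞) :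
    (∑' m, f m) ^ 2 ≤ 4 * ∑' m, (b ^ 2) ^ m * f m ^ 2 := by
  set T2 := ∑' m, (b ^ 2) ^ m * f m ^ 2 with hT2
  obtain ⟨T, hT⟩ : ∃ T : ℝ≥0∞, T ^ 2 = T2 := by
    refine ⟨T2 ^ (1 / 2 : ℝ), ?_⟩
    rw [← ENNReal.rpow_natCast, ← ENNReal.rpow_mul]
    norm_num
  have hb0 : b ≠ 0 := by
    rintro rfl
    simp at hb
  have h1 : ∀ m, f m ≤ (b⁻¹) ^ m * T := by
    intro m
    have h2 : (b ^ m * f m) ^ 2 ≤ T ^ 2 := by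
      rw [hT, mul_pow, ← pow_mul, mul_comm m 2, pow_mul]
      exact ENNReal.le_tsum (f := fun m => (b ^ 2) ^ m * f m ^ 2) m
    have h3 : b ^ m * f m ≤ T := by
      exact (ENNReal.pow_le_pow_left_iff two_ne_zero).1 h2
    calc f m = (b⁻¹) ^ m * (b ^ m * f m) := by
          rw [← mul_assoc, ← mul_pow, ENNReal.inv_mul_cancel hb0 hbt, one_pow, one_mul]
      _ ≤ _ := by gcongr
  have h4 : ∑' m, f m ≤ 2 * T := by
    calc ∑' m, f m ≤ ∑' m, (2⁻¹ : ℝ≥0∞) ^ m * T := by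
          refine ENNReal.tsum_le_tsum fun m => (h1 m).trans ?_
          gcongr
      _ = 2 * T := by
          rw [ENNReal.tsum_mul_right, ENNReal.tsum_geometric, ENNReal.one_sub_inv_two, inv_inv]
  calc (∑' m, f m) ^ 2 ≤ (2 * T) ^ 2 := by gcongr
    _ = 4 * T2 := by rw [mul_pow, hT]; norm_num

theorem dm_add_sq (a b : ℝ≥0∞) : (a + b) ^ 2 ≤ 2 * a ^ 2 + 2 * b ^ 2 := by
  have := ENNReal.rpow_add_le_mul_rpow_add_rpow a b (p := 2) (by norm_num)
  norm_num at this
  rw [mul_add] at this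
  exact_mod_cast this

namespace DMNet

variable {d : ℕ} (S : DMNet d)

theorem r_pow (i m : ℕ) : S.r i = (150 * S.N : ℝ) ^ m * S.r (i + m) := by
  induction m with
  | zero => simp
  | succ m ih =>
    rw [ih, S.r_succ (i + m), pow_succ]
    ring_nf

theorem exists_scale (i : ℕ) (ρ : ℝ) (hρ : 0 < ρ) (h : ρ < S.r i) :
    ∃ m, S.r (i + m + 1) ≤ ρ ∧ ρ < S.r (i + m) := by
  have h1 : (1 : ℝ) ≤ S.N := by exact_mod_cast S.hN
  have hex : ∃ m, S.r (i + m) ≤ ρ := by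
    obtain ⟨m, hm⟩ := pow_unbounded_of_one_lt (S.r i / ρ) (show (1 : ℝ) < 150 * S.N by linarith)
    refine ⟨m, ?_⟩
    rw [div_lt_iff₀ hρ, S.r_pow i m] at hm
    have : (0 : ℝ) < (150 * S.N) ^ m := by positivity
    exact (lt_of_mul_lt_mul_left hm this.le).le
  classical
  have h2 := Nat.find_spec hex
  have h3 : Nat.find hex ≠ 0 := by
    intro h0
    rw [h0] at h2
    simp at h2
    linarith
  have h4 := Nat.find_min hex (m := Nat.find hex - 1) (by omega)
  refine ⟨Nat.find hex - 1, ?_, not_le.1 h4⟩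
  rwa [show i + (Nat.find hex - 1) + 1 = i + Nat.find hex by omega]

theorem kernel_bd (n i : ℕ) (x y : EV d) (hxy : x ≠ y) :
    (ENNReal.ofReal (dist x y ^ n))⁻¹ ≤ (ENNReal.ofReal (S.r i ^ n))⁻¹ +
      ∑' m, (ENNReal.ofReal (S.r (i + m + 1) ^ n))⁻¹ *
        (ball x (S.r (i + m))).indicator 1 y := by
  have hpos := dist_pos.2 hxy
  rcases le_or_gt (S.r i) (dist x y) with h | h
  · refine le_trans ?_ le_self_add
    rw [ENNReal.inv_le_inv]
    have := S.r_pos i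
    gcongr
  · refine le_trans ?_ le_add_self
    obtain ⟨m, h1, h2⟩ := S.exists_scale i _ hpos h
    refine le_trans ?_ (ENNReal.le_tsum m)
    rw [indicator_of_mem (by rwa [mem_ball, dist_comm]), Pi.one_apply, mul_one,
      ENNReal.inv_le_inv]
    have := S.r_pos (i + m + 1)
    gcongr

theorem inv_r_succ (n j : ℕ) : (ENNReal.ofReal (S.r (j + 1) ^ n))⁻¹ =
    ENNReal.ofReal (150 * S.N) ^ n * (ENNReal.ofReal (S.r j ^ n))⁻¹ := by
  have h1 : (0 : ℝ) < S.N := by exact_mod_cast S.hN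
  have h2 : ENNReal.ofReal (150 * S.N) ^ n ≠ 0 := by
    apply pow_ne_zero
    simpa using S.hN.ne'
  have h3 : ENNReal.ofReal (150 * S.N) ^ n ≠ ∞ := ENNReal.pow_ne_top ENNReal.ofReal_ne_top
  have h4 : ENNReal.ofReal (S.r j ^ n) =
      ENNReal.ofReal (150 * S.N) ^ n * ENNReal.ofReal (S.r (j + 1) ^ n) := by
    rw [S.r_succ j, mul_pow, ENNReal.ofReal_mul (by positivity),
      ENNReal.ofReal_pow (show (0 : ℝ) ≤ 150 * S.N by positivity)]
  rw [h4, ENNReal.mul_inv (Or.inl h2) (Or.inl h3), ← mul_assoc, ENNReal.mul_inv_cancel h2 h3, one_mul]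

theorem potential_bd (μ : Measure (EV d)) (n i : ℕ) (z x : EV d) (T : Set (EV d))
    (hx : x ∈ S.E) (hT : MeasurableSet T) (hTE : T ⊆ S.E)
    (hsep : ∀ y ∈ T, (S.L i x = z ∧ S.L i y ≠ z) ∨ (S.L i x ≠ z ∧ S.L i y = z)) :
    ∫⁻ y in T, (ENNReal.ofReal (dist x y ^ n))⁻¹ ∂μ ≤ μ T / ENNReal.ofReal (S.r i ^ n) +
      ENNReal.ofReal (150 * S.N) ^ n *
        ∑' m, dmTheta μ n S.r (i + m) x * (S.Nb i m z).indicator 1 x := by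
  calc ∫⁻ y in T, (ENNReal.ofReal (dist x y ^ n))⁻¹ ∂μ
      ≤ ∫⁻ y in T, ((ENNReal.ofReal (S.r i ^ n))⁻¹ +
      ∑' m, (ENNReal.ofReal (S.r (i + m + 1) ^ n))⁻¹ *
        (ball x (S.r (i + m))).indicator 1 y) ∂μ := by
        refine setLIntegral_mono' hT fun y hy => S.kernel_bd n i x y ?_
        rintro rfl
        have := hsep x hy
        grind
    _ = μ T / ENNReal.ofReal (S.r i ^ n) + ∑' m, (ENNReal.ofReal (S.r (i + m + 1) ^ n))⁻¹ *
        μ (ball x (S.r (i + m)) ∩ T) := by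
        rw [lintegral_add_left measurable_const, setLIntegral_const, lintegral_tsum]
        · congr 1
          · rw [div_eq_mul_inv, mul_comm]
          · refine tsum_congr fun m => ?_
            rw [lintegral_const_mul _ (measurable_one.indicator measurableSet_ball),
              lintegral_indicator_one measurableSet_ball,
              Measure.restrict_apply measurableSet_ball]
        · intro m
          exact ((measurable_one.indicator measurableSet_ball).const_mul _).aemeasurable
    _ ≤ _ := by
        gcongr
        rw [← ENNReal.tsum_mul_left]
        refine ENNReal.tsum_le_tsum fun m => ?_
        rw [S.inv_r_succ, mul_assoc]
        refine mul_le_mul_right ?_ _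
        by_cases hm : x ∈ S.Nb i m z
        · rw [indicator_of_mem hm, Pi.one_apply, mul_one, dmTheta, div_eq_mul_inv, mul_comm]
          gcongr
          exact inter_subset_left
        · have : ball x (S.r (i + m)) ∩ T = ∅ := by
            rw [Set.eq_empty_iff_forall_notMem]
            rintro y ⟨hy1, hy2⟩
            apply hm
            refine ⟨hx, y, hTE hy2, ?_, hsep y hy2⟩
            rwa [mem_ball, dist_comm] at hy1
          rw [this]
          simp

theorem energy_half {b : ℝ≥0∞} (hb : 2 ≤ b) (hbt : b ≠ ∞)
    (μ ν : Measure (EV d)) [IsFiniteMeasure μ] (n i : ℕ) (z : EV d) (U T : Set (EV d))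
    (hU : MeasurableSet U) (hT : MeasurableSet T) (hUE : U ⊆ S.E) (hTE : T ⊆ S.E)
    (hsep : ∀ x ∈ U, ∀ y ∈ T, (S.L i x = z ∧ S.L i y ≠ z) ∨ (S.L i x ≠ z ∧ S.L i y = z))
    (hν : ∀ M, ∑ m ∈ Finset.range M, (b ^ 2) ^ m * dmSigma μ n S.r (i + m) (S.Nb i m z) ≤
      2 * ν (ball z (40 * S.r i))) :
    ∫⁻ x in U, (∫⁻ y in T, (ENNReal.ofReal (dist x y ^ n))⁻¹ ∂μ) ^ 2 ∂μ ≤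
      2 * (μ T / ENNReal.ofReal (S.r i ^ n)) ^ 2 * μ U +
        16 * (ENNReal.ofReal (150 * S.N) ^ n) ^ 2 * ν (ball z (40 * S.r i)) := by
  set a := μ T / ENNReal.ofReal (S.r i ^ n)
  set AA := ENNReal.ofReal (150 * S.N) ^ n
  have hmeas : ∀ m, Measurable fun x => (S.Nb i m z).indicator 
      (fun x => dmTheta μ n S.r (i + m) x ^ 2) x := fun m =>
    ((dm_measurable_theta μ n S.r (i + m)).pow_const 2).indicator (S.measurable_Nb i m z)
  calc _ ≤ ∫⁻ x in U, (2 * a ^ 2 + ∑' m, (8 * AA ^ 2 * (b ^ 2) ^ m) * (S.Nb i m z).indicator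
        (fun x => dmTheta μ n S.r (i + m) x ^ 2) x) ∂μ := by
        refine setLIntegral_mono' hU fun x hx => ?_
        calc _ ≤ (a + AA * ∑' m, dmTheta μ n S.r (i + m) x * (S.Nb i m z).indicator 1 x) ^ 2 := by
              gcongr
              exact S.potential_bd μ n i z x T (hUE hx) hT hTE (hsep x hx)
          _ ≤ _ := dm_add_sq _ _
          _ ≤ _ := by
              gcongr
              rw [mul_pow]
              calc _ ≤ 2 * (AA ^ 2 * (4 * ∑' m, (b ^ 2) ^ m * (dmTheta μ n S.r (i + m) x *
                    (S.Nb i m z).indicator 1 x) ^ 2)) := by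
                    gcongr
                    exact dm_tsum_sq _ b hb hbt
                _ = _ := by
                    rw [← mul_assoc, ← mul_assoc, ← ENNReal.tsum_mul_left]
                    refine tsum_congr fun m => ?_
                    by_cases hm : x ∈ S.Nb i m z
                    · rw [indicator_of_mem hm, indicator_of_mem hm, Pi.one_apply, mul_one]
                      ring
                    · rw [indicator_of_notMem hm, indicator_of_notMem hm]
                      simp
    _ = 2 * a ^ 2 * μ U + ∑' m, (8 * AA ^ 2 * (b ^ 2) ^ m) * ∫⁻ x in U, (S.Nb i m z).indicator
        (fun x => dmTheta μ n S.r (i + m) x ^ 2) x ∂μ := by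
        rw [lintegral_add_left measurable_const, setLIntegral_const, lintegral_tsum]
        · congr 1
          refine tsum_congr fun m => ?_
          rw [lintegral_const_mul _ (hmeas m)]
        · intro m
          exact ((hmeas m).const_mul _).aemeasurable
    _ ≤ 2 * a ^ 2 * μ U + ∑' m, (8 * AA ^ 2) * ((b ^ 2) ^ m *
        dmSigma μ n S.r (i + m) (S.Nb i m z)) := by
        gcongr 2 * a ^ 2 * μ U + ?_
        refine ENNReal.tsum_le_tsum fun m => ?_
        rw [← mul_assoc]
        gcongr
        rw [dmSigma, withDensity_apply _ (S.measurable_Nb i m z),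
          ← lintegral_indicator (S.measurable_Nb i m z)]
        exact lintegral_mono' Measure.restrict_le_self le_rfl
    _ ≤ 2 * a ^ 2 * μ U + (8 * AA ^ 2) * (2 * ν (ball z (40 * S.r i))) := by
        rw [ENNReal.tsum_mul_left]
        gcongr
        exact ENNReal.tsum_le_of_sum_range_le hν
    _ = _ := by ring

/-- Bounding the combined measure by cubes. -/
theorem nu_le (μ : Measure (EV d)) (hμE : μ S.Eᶜ = 0) (n i : ℕ) (g : ℝ≥0∞) (z : EV d) :
    dmNu μ n S.r g i (ball z (40 * S.r i)) ≤
      ∑' m, g ^ m * ∑' w : {w // w ∈ S.X (i + m) ∧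
          (S.Q (i + m) w ∩ ball z (40 * S.r i)).Nonempty},
        ((μ (ball w.1 (56 * S.r (i + m))) / ENNReal.ofReal (S.r (i + m) ^ n)) ^ 2 *
          μ (S.Q (i + m) w)) := by
  rw [dm_nu_apply _ _ _ _ _ _ measurableSet_ball]
  refine ENNReal.tsum_le_tsum fun m => ?_
  gcongr
  rw [dmSigma, withDensity_apply _ measurableSet_ball]
  set W := {w // w ∈ S.X (i + m) ∧ (S.Q (i + m) w ∩ ball z (40 * S.r i)).Nonempty} with hW
  have hfin : Countable W := by
    have : ({w | w ∈ S.X (i + m) ∧ (S.Q (i + m) w ∩ ball z (40 * S.r i)).Nonempty}).Finite :=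
      (S.X (i + m)).finite_toSet.subset fun w hw => hw.1
    exact this.countable.to_subtype
  have hsub : ball z (40 * S.r i) ⊆ (⋃ w : W, S.Q (i + m) w.1) ∪ S.Eᶜ := by
    intro x hx
    by_cases hxE : x ∈ S.E
    · left
      rw [mem_iUnion]
      exact ⟨⟨S.L (i + m) x, S.L_mem _ x hxE, x, ⟨hxE, rfl⟩, hx⟩, hxE, rfl⟩
    · right; exact hxE
  calc ∫⁻ x in ball z (40 * S.r i), dmTheta μ n S.r (i + m) x ^ 2 ∂μ
      ≤ ∫⁻ x in (⋃ w : W, S.Q (i + m) w.1) ∪ S.Eᶜ, dmTheta μ n S.r (i + m) x ^ 2 ∂μ :=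
        lintegral_mono_set hsub
    _ ≤ ∫⁻ x in (⋃ w : W, S.Q (i + m) w.1), dmTheta μ n S.r (i + m) x ^ 2 ∂μ +
        ∫⁻ x in S.Eᶜ, dmTheta μ n S.r (i + m) x ^ 2 ∂μ := lintegral_union_le _ _ _
    _ = ∫⁻ x in (⋃ w : W, S.Q (i + m) w.1), dmTheta μ n S.r (i + m) x ^ 2 ∂μ := by
        rw [setLIntegral_measure_zero _ _ hμE, add_zero]
    _ ≤ ∑' w : W, ∫⁻ x in S.Q (i + m) w.1, dmTheta μ n S.r (i + m) x ^ 2 ∂μ :=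
        lintegral_iUnion_le _ _
    _ ≤ _ := by
        refine ENNReal.tsum_le_tsum fun w => ?_
        rw [← setLIntegral_const]
        refine setLIntegral_mono' (S.measurable_Q _ _) fun x hx => ?_
        unfold dmTheta
        gcongr
        apply ball_subset_ball'
        have h1 := S.L_dist (i + m) x hx.1
        rw [hx.2] at h1
        have := S.r_pos (i + m)
        linarith

end DMNet

theorem dm_constants (D : ℕ) (hD : 0 < D) (γ : ℝ) (hγ1 : γ < 1) :
    ∃ N : ℕ, 100 ≤ N ∧ ∃ b : ℝ, 2 ≤ b ∧
      2 * b ^ 2 * (D * (D * (2 / N))) ≤ (150 * N : ℝ) ^ (-γ) := by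
  have h1 : Filter.Tendsto (fun N : ℕ => (150 * N : ℝ) ^ ((1 - γ) / 4)) Filter.atTop
      Filter.atTop := by
    refine (tendsto_rpow_atTop (by linarith)).comp ?_
    exact Filter.Tendsto.const_mul_atTop (by norm_num) tendsto_natCast_atTop_atTop
  obtain ⟨N, hN1, hN2⟩ := ((h1.eventually_ge_atTop (600 * (D : ℝ) ^ 2)).and
    (Filter.eventually_ge_atTop 100)).exists
  have hD' : (1 : ℝ) ≤ D := by exact_mod_cast hD
  have hN' : (100 : ℝ) ≤ N := by exact_mod_cast hN2
  set b := (150 * N : ℝ) ^ ((1 - γ) / 4) with hb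
  have hb2 : 2 ≤ b := by nlinarith
  refine ⟨N, hN2, b, hb2, ?_⟩
  have h4 : (150 * N : ℝ) ^ (-γ) = b ^ 4 * (150 * N : ℝ)⁻¹ := by
    rw [hb, ← Real.rpow_natCast, ← Real.rpow_mul (by positivity),
      ← Real.rpow_neg_one (150 * (N : ℝ)), ← Real.rpow_add (by positivity)]
    congr 1
    push_cast
    ring
  rw [h4]
  have h5 : 600 * (D : ℝ) ^ 2 ≤ b ^ 2 := by nlinarith
  have e1 : 2 * b ^ 2 * ((D : ℝ) * (D * (2 / N))) = b ^ 2 * (600 * (D : ℝ) ^ 2) * (150 * N : ℝ)⁻¹ := by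
    field_simp
    ring
  rw [e1]
  have : b ^ 4 = b ^ 2 * b ^ 2 := by ring
  rw [this]
  gcongr

/-- Construction of the net with good radii. -/
theorem dm_exists_net {d : ℕ} (μ : Measure (EV d)) (n : ℕ) (g : ℝ≥0∞) (E : Set (EV d))
    (hE : IsCompact E) (N : ℕ) (hN : 0 < N) (k₀ : ℤ) :
    ∃ S : DMNet d, S.E = E ∧ S.N = N ∧ (∀ i : ℕ, S.r i = (150 * N : ℝ) ^ (-(k₀ + i))) ∧
      ∀ i, ∀ j ∈ S.X i,
        μ (dmAnn S.N (S.r i) j (S.t i j)) ≤ (2 / S.N) * μ (ball j (13 * S.r i)) ∧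
        dmNu μ n S.r g i (dmAnn S.N (S.r i) j (S.t i j)) ≤
          (2 / S.N) * dmNu μ n S.r g i (ball j (13 * S.r i)) := by
  have hN' : (0 : ℝ) < N := by exact_mod_cast hN
  set r : ℕ → ℝ := fun i => (150 * N : ℝ) ^ (-(k₀ + i)) with hr
  have r_pos : ∀ i, 0 < r i := fun i => by
    simp only [hr]; positivity
  have hX := fun i => dm_net E hE (r i) (r_pos i)
  choose X h1 h2 h3 using hX
  have ht := fun i z => dm_pigeon N hN (r i) (r_pos i) z μ (dmNu μ n r g i)
  choose t ht1 ht2 ht3 using ht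
  refine ⟨⟨E, N, r, X, t, hE.isClosed, hN, r_pos, ?_, h1, h2, h3, fun i a _ => ht1 i a⟩,
    rfl, rfl, fun i => rfl, fun i j hj => ⟨ht2 i j, ht3 i j⟩⟩
  intro i
  simp only [hr]
  rw [← zpow_one_add₀ (by positivity)]
  congr 1
  push_cast
  ring

namespace DMNet

variable {d : ℕ} (S : DMNet d)

theorem mem_Q_self (i : ℕ) (z : EV d) (hz : z ∈ S.X i) : z ∈ S.Q i z :=
  ⟨S.XE i z hz, S.L_core i z z (S.XE i z hz) hz (by simpa using S.r_pos i)⟩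

theorem Q_inj (i : ℕ) (z w : EV d) (hz : z ∈ S.X i) (h : S.Q i z = S.Q i w) : z = w := by
  have h1 := S.mem_Q_self i z hz
  have h2 := h1
  rw [h] at h2
  exact h1.2.symm.trans h2.2

theorem Q_sub_ball (i : ℕ) (z : EV d) : S.Q i z ⊆ ball z (13 * S.r i) := by
  rintro x ⟨hx, rfl⟩
  exact S.L_dist i x hx

/-- The energy estimate in internal terms. -/
theorem energy_full {b g : ℝ≥0∞} (hb : 2 ≤ b) (hbt : b ≠ ∞)
    (μ : Measure (EV d)) [IsFiniteMeasure μ] (hμE : μ S.Eᶜ = 0) (n i : ℕ) (z : EV d)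
    (hz : z ∈ S.X i)
    (hν : ∀ M, ∑ m ∈ Finset.range M, (b ^ 2) ^ m * dmSigma μ n S.r (i + m) (S.Nb i m z) ≤
      2 * dmNu μ n S.r g i (ball z (40 * S.r i))) :
    (∫⁻ x in ball z (56 * S.r i) \ S.Q i z,
        (∫⁻ y in S.Q i z, (ENNReal.ofReal (dist x y ^ n))⁻¹ ∂μ) ^ 2 ∂μ) +
      (∫⁻ x in S.Q i z,
        (∫⁻ y in ball z (56 * S.r i) \ S.Q i z,
          (ENNReal.ofReal (dist x y ^ n))⁻¹ ∂μ) ^ 2 ∂μ) ≤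
    (4 + 32 * (ENNReal.ofReal (150 * S.N) ^ n) ^ 2) *
      ∑' m, g ^ m * ∑' w : {w // w ∈ S.X (i + m) ∧
          (S.Q (i + m) w ∩ ball z (40 * S.r i)).Nonempty},
        ((μ (ball w.1 (56 * S.r (i + m))) / ENNReal.ofReal (S.r (i + m) ^ n)) ^ 2 *
          μ (S.Q (i + m) w)) := by
  set AA := ENNReal.ofReal (150 * S.N) ^ n
  set W := (ball z (56 * S.r i) \ S.Q i z) ∩ S.E with hW
  have hr := S.r_pos i
  have hae : (ball z (56 * S.r i) \ S.Q i z : Set (EV d)) =ᵐ[μ] W := by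
    rw [ae_eq_set]
    constructor
    · refine measure_mono_null ?_ hμE
      intro x hx hxE
      exact hx.2 ⟨hx.1, hxE⟩
    · refine measure_mono_null (t := ∅) ?_ measure_empty
      intro x hx
      exact hx.2 hx.1.1
  have hWm : MeasurableSet W :=
    (measurableSet_ball.diff (S.measurable_Q i z)).inter S.hE.measurableSet
  have hWE : W ⊆ S.E := inter_subset_right
  have hQE : S.Q i z ⊆ S.E := fun x hx => hx.1
  have hWn : ∀ x ∈ W, S.L i x ≠ z := fun x hx h => hx.1.2 ⟨hx.2, h⟩
  have hQW : μ (S.Q i z) ≤ μ (ball z (56 * S.r i)) := measure_mono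
    ((S.Q_sub_ball i z).trans (ball_subset_ball (by linarith)))
  have hWb : μ W ≤ μ (ball z (56 * S.r i)) := measure_mono fun x hx => hx.1.1
  set R := ∑' m, g ^ m * ∑' w : {w // w ∈ S.X (i + m) ∧
          (S.Q (i + m) w ∩ ball z (40 * S.r i)).Nonempty},
        ((μ (ball w.1 (56 * S.r (i + m))) / ENNReal.ofReal (S.r (i + m) ^ n)) ^ 2 *
          μ (S.Q (i + m) w)) with hR
  have hνR : dmNu μ n S.r g i (ball z (40 * S.r i)) ≤ R := S.nu_le μ hμE n i g z
  set TQ := (μ (ball z (56 * S.r i)) / ENNReal.ofReal (S.r i ^ n)) ^ 2 * μ (S.Q i z) with hTQ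
  have hTR : TQ ≤ R := by
    refine le_trans ?_ (ENNReal.le_tsum 0)
    rw [pow_zero, one_mul]
    have hz' := S.mem_Q_self i z hz
    exact ENNReal.le_tsum (f := fun w : {w // w ∈ S.X (i + 0) ∧
          (S.Q (i + 0) w ∩ ball z (40 * S.r i)).Nonempty} =>
        ((μ (ball w.1 (56 * S.r (i + 0))) / ENNReal.ofReal (S.r (i + 0) ^ n)) ^ 2 *
          μ (S.Q (i + 0) w))) ⟨z, hz, z, hz', mem_ball_self (by positivity)⟩
  have I1 := S.energy_half hb hbt μ (dmNu μ n S.r g i) n i z W (S.Q i z) hWm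
    (S.measurable_Q i z) hWE hQE (fun x hx y hy => Or.inr ⟨hWn x hx, hy.2⟩) hν
  have I2 := S.energy_half hb hbt μ (dmNu μ n S.r g i) n i z (S.Q i z) W
    (S.measurable_Q i z) hWm hQE hWE (fun x hx y hy => Or.inl ⟨hx.2, hWn y hy⟩) hν
  rw [setLIntegral_congr hae]
  simp_rw [setLIntegral_congr hae]
  have J1 : (μ (S.Q i z) / ENNReal.ofReal (S.r i ^ n)) ^ 2 * μ W ≤ TQ := by
    rw [hTQ]
    simp only [div_eq_mul_inv, mul_pow]
    set c := (ENNReal.ofReal (S.r i ^ n))⁻¹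
    calc μ (S.Q i z) ^ 2 * c ^ 2 * μ W
        ≤ (μ (ball z (56 * S.r i)) * μ (S.Q i z)) * c ^ 2 * μ (ball z (56 * S.r i)) := by
          rw [pow_two (μ (S.Q i z))]
          gcongr
      _ = _ := by ring
  have J2 : (μ W / ENNReal.ofReal (S.r i ^ n)) ^ 2 * μ (S.Q i z) ≤ TQ := by
    rw [hTQ]
    gcongr
  refine (add_le_add I1 I2).trans ?_
  have K1 : 2 * (μ (S.Q i z) / ENNReal.ofReal (S.r i ^ n)) ^ 2 * μ W ≤ 2 * R := by
    rw [mul_assoc]; exact mul_le_mul_right (J1.trans hTR) _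
  have K2 : 2 * (μ W / ENNReal.ofReal (S.r i ^ n)) ^ 2 * μ (S.Q i z) ≤ 2 * R := by
    rw [mul_assoc]; exact mul_le_mul_right (J2.trans hTR) _
  have K3 : 16 * AA ^ 2 * dmNu μ n S.r g i (ball z (40 * S.r i)) ≤ 16 * AA ^ 2 * R :=
    mul_le_mul_right hνR _
  calc _ ≤ (2 * R + 16 * AA ^ 2 * R) + (2 * R + 16 * AA ^ 2 * R) :=
        add_le_add (add_le_add K1 K3) (add_le_add K2 K3)
    _ = _ := by ring

end DMNet

theorem dm_support_nontrivial {d n : ℕ} (hn : 1 ≤ n) (μ : Measure (EV d)) (c : ℝ)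
    (hc : ∀ x ∈ measSupport μ, ∀ r : ℝ, 0 < r → μ (ball x r) ≤ ENNReal.ofReal (c * r ^ n))
    (p : EV d) (hp : p ∈ measSupport μ) : ∃ p' ∈ measSupport μ, p ≠ p' := by
  by_contra! hcon
  have hE : (measSupport μ)ᶜ = {p}ᶜ := by
    congr 1
    ext x
    constructor
    · intro hx; exact (hcon x hx).symm
    · rintro rfl; exact hp
  have h0 : μ {p}ᶜ = 0 := by rw [← hE]; exact dm_support_compl_null μ
  have h1 : ∀ r : ℝ, 0 < r → μ (ball p 1) ≤ ENNReal.ofReal (c * r ^ n) := by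
    intro r hr
    calc μ (ball p 1) ≤ μ ({p} ∪ {p}ᶜ) := measure_mono (by simp)
      _ ≤ μ {p} + μ {p}ᶜ := measure_union_le _ _
      _ = μ {p} := by rw [h0, add_zero]
      _ ≤ μ (ball p r) := measure_mono (by simpa using hr)
      _ ≤ _ := hc p hp r hr
  have h2 : Filter.Tendsto (fun r : ℝ => ENNReal.ofReal (c * r ^ n)) (nhdsWithin 0 (Ioi 0))
      (nhds 0) := by
    have : Filter.Tendsto (fun r : ℝ => ENNReal.ofReal (c * r ^ n)) (nhds 0)
        (nhds (ENNReal.ofReal (c * 0 ^ n))) :=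
      (ENNReal.continuous_ofReal.comp (by fun_prop)).tendsto (0 : ℝ)
    rw [zero_pow (by omega), mul_zero, ENNReal.ofReal_zero] at this
    exact this.mono_left nhdsWithin_le_nhds
  have h3 : μ (ball p 1) ≤ 0 := ge_of_tendsto h2 (by
    filter_upwards [self_mem_nhdsWithin] with r hr using h1 r hr)
  exact absurd (hp 1 one_pos) (not_lt.2 h3)

namespace DMNet

variable {d : ℕ} (S : DMNet d)

/-- The cubes of generation `k`. -/
def gen (k₀ k : ℤ) : Set (Set (EV d)) :=
  {Q | ∃ z ∈ S.X (k - k₀).toNat, S.Q (k - k₀).toNat z = Q}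

/-- The centre of a cube of generation `k`. -/
def cen (k₀ k : ℤ) (Q : Set (EV d)) : EV d :=
  Classical.epsilon fun z => z ∈ S.X (k - k₀).toNat ∧ S.Q (k - k₀).toNat z = Q

theorem mem_gen (k₀ : ℤ) (i : ℕ) (Q : Set (EV d)) :
    Q ∈ S.gen k₀ (k₀ + i) ↔ ∃ z ∈ S.X i, S.Q i z = Q := by
  have : (k₀ + (i : ℤ) - k₀).toNat = i := by omega
  change (∃ z ∈ S.X (k₀ + (i : ℤ) - k₀).toNat, S.Q (k₀ + (i : ℤ) - k₀).toNat z = Q) ↔ _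
  rw [this]

theorem cen_Q (k₀ : ℤ) (i : ℕ) (z : EV d) (hz : z ∈ S.X i) :
    S.cen k₀ (k₀ + i) (S.Q i z) = z := by
  have : (k₀ + (i : ℤ) - k₀).toNat = i := by omega
  unfold cen
  rw [this]
  have h : ∃ w, w ∈ S.X i ∧ S.Q i w = S.Q i z := ⟨z, hz, rfl⟩
  have h2 := Classical.epsilon_spec h
  exact S.Q_inj i _ z h2.1 h2.2

theorem Q_nest (i m : ℕ) (w x y : EV d) (hx : x ∈ S.Q (i + m) w) (hy : y ∈ S.Q (i + m) w) :
    S.L i x = S.L i y :=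
  S.L_nest i m x y hx.1 hy.1 (hx.2.trans hy.2.symm)

theorem rhs_le (μ : Measure (EV d)) (n : ℕ) (γ : ℝ) (k₀ : ℤ)
    (A : ℝ) (hA : 1 < A) (hr : ∀ i : ℕ, S.r i = A ^ (-(k₀ + i))) (i : ℕ) (z : EV d)
    (hz : z ∈ S.X i) :
    ∑' m, ENNReal.ofReal (A ^ (-γ)) ^ m * ∑' w : {w // w ∈ S.X (i + m) ∧
          (S.Q (i + m) w ∩ ball z (40 * S.r i)).Nonempty},
        ((μ (ball w.1 (56 * S.r (i + m))) / ENNReal.ofReal (S.r (i + m) ^ n)) ^ 2 *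
          μ (S.Q (i + m) w)) ≤
    (ENNReal.ofReal (112 ^ n)) ^ 2 *
      ∑' P : {q : ℤ × Set (EuclideanSpace ℝ (Fin d)) //
                    (k₀ + (i : ℤ)) ≤ q.1 ∧ q.2 ∈ S.gen k₀ q.1 ∧
                    q.2 ⊆ ⋃₀ {P' | P' ∈ S.gen k₀ (k₀ + i) ∧
                      infDist (S.cen k₀ (k₀ + i) (S.Q i z)) P' ≤
                        2 * sideLength 2 A (k₀ + i)}},
                  ENNReal.ofReal ((sideLength 2 A P.1.1 / sideLength 2 A (k₀ + i)) ^ γ) *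
                    (μ (ball (S.cen k₀ P.1.1 P.1.2) (56 * A ^ (-P.1.1))) /
                        ENNReal.ofReal (sideLength 2 A P.1.1 ^ n)) ^ 2 *
                    μ P.1.2 := by
  have hA0 : 0 < A := by linarith
  have hri := S.r_pos i
  simp_rw [← ENNReal.tsum_mul_left]
  rw [← ENNReal.tsum_sigma' (β := fun m => {w // w ∈ S.X (i + m) ∧
          (S.Q (i + m) w ∩ ball z (40 * S.r i)).Nonempty})
    (f := fun p => ENNReal.ofReal (A ^ (-γ)) ^ p.1 *
      ((μ (ball p.2.1 (56 * S.r (i + p.1))) / ENNReal.ofReal (S.r (i + p.1) ^ n)) ^ 2 *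
          μ (S.Q (i + p.1) p.2)))]
  have hkm : ∀ m : ℕ, k₀ + (i : ℤ) + (m : ℤ) = k₀ + ((i + m : ℕ) : ℤ) := fun m => by
    push_cast; ring
  have hφ : ∀ p : (Σ m, {w // w ∈ S.X (i + m) ∧
          (S.Q (i + m) w ∩ ball z (40 * S.r i)).Nonempty}),
      (k₀ + (i : ℤ)) ≤ k₀ + ((i + p.1 : ℕ) : ℤ) ∧
      S.Q (i + p.1) p.2.1 ∈ S.gen k₀ (k₀ + ((i + p.1 : ℕ) : ℤ)) ∧
      S.Q (i + p.1) p.2.1 ⊆ ⋃₀ {P' | P' ∈ S.gen k₀ (k₀ + i) ∧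
                      infDist (S.cen k₀ (k₀ + i) (S.Q i z)) P' ≤
                        2 * sideLength 2 A (k₀ + i)} := by
    rintro ⟨m, w, hw, x, hxQ, hxb⟩
    refine ⟨by push_cast; omega, (S.mem_gen _ _ _).2 ⟨w, hw, rfl⟩, ?_⟩
    intro y hy
    refine ⟨S.Q i (S.L i x), ⟨(S.mem_gen _ _ _).2 ⟨_, S.L_mem i x hxQ.1, rfl⟩, ?_⟩,
      ⟨hy.1, S.Q_nest i m w y x hy hxQ⟩⟩
    rw [S.cen_Q k₀ i z hz]
    have hxm : x ∈ S.Q i (S.L i x) := ⟨hxQ.1, rfl⟩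
    refine (infDist_le_dist_of_mem hxm).trans ?_
    rw [dist_comm]
    have h1 : dist x z < 40 * S.r i := hxb
    unfold sideLength
    rw [← hr i]
    linarith
  set φ : (Σ m, {w // w ∈ S.X (i + m) ∧
          (S.Q (i + m) w ∩ ball z (40 * S.r i)).Nonempty}) →
    {q : ℤ × Set (EuclideanSpace ℝ (Fin d)) //
                    (k₀ + (i : ℤ)) ≤ q.1 ∧ q.2 ∈ S.gen k₀ q.1 ∧
                    q.2 ⊆ ⋃₀ {P' | P' ∈ S.gen k₀ (k₀ + i) ∧
                      infDist (S.cen k₀ (k₀ + i) (S.Q i z)) P' ≤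
                        2 * sideLength 2 A (k₀ + i)}} :=
    fun p => ⟨(k₀ + ((i + p.1 : ℕ) : ℤ), S.Q (i + p.1) p.2.1), hφ p⟩ with hφdef
  have hinj : Function.Injective φ := by
    rintro ⟨m, w, hw⟩ ⟨m', w', hw'⟩ h
    have h1 := congrArg (fun q => q.1.1) h
    have h2 := congrArg (fun q => q.1.2) h
    simp only [hφdef] at h1 h2
    have : m = m' := by push_cast at h1; omega
    subst this
    have : w = w' := S.Q_inj _ _ _ hw.1 h2
    subst this
    rfl
  refine le_trans (ENNReal.tsum_le_tsum ?_) (ENNReal.tsum_comp_le_tsum_of_injective hinj _)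
  rintro ⟨m, w, hw⟩
  simp only [hφdef]
  rw [S.cen_Q k₀ (i + m) w hw.1, ← hr (i + m)]
  have e1 : ENNReal.ofReal ((sideLength 2 A (k₀ + ((i + m : ℕ) : ℤ)) /
      sideLength 2 A (k₀ + i)) ^ γ) = ENNReal.ofReal (A ^ (-γ)) ^ m := by
    have h1 : sideLength 2 A (k₀ + ((i + m : ℕ) : ℤ)) / sideLength 2 A (k₀ + i) =
        A ^ (-(m : ℝ)) := by
      unfold sideLength
      rw [Real.rpow_neg hA0.le, Real.rpow_natCast, mul_div_mul_left _ _ (by norm_num),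
        ← zpow_sub₀ hA0.ne', ← zpow_natCast, ← zpow_neg]
      congr 1
      push_cast
      ring
    rw [h1, ← Real.rpow_mul hA0.le, ← ENNReal.ofReal_pow (by positivity),
      ← Real.rpow_natCast, ← Real.rpow_mul hA0.le]
    congr 2
    ring
  have e2 : sideLength 2 A (k₀ + ((i + m : ℕ) : ℤ)) = 112 * S.r (i + m) := by
    unfold sideLength
    rw [hr (i + m)]
    norm_num
  rw [e1, e2]
  have hrp := S.r_pos (i + m)
  have e3 : μ (ball w (56 * S.r (i + m))) / ENNReal.ofReal (S.r (i + m) ^ n) =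
      ENNReal.ofReal (112 ^ n) *
        (μ (ball w (56 * S.r (i + m))) / ENNReal.ofReal ((112 * S.r (i + m)) ^ n)) := by
    have h0 : ENNReal.ofReal (112 ^ n) ≠ 0 := by
      simp only [ne_eq, ENNReal.ofReal_eq_zero, not_le]; positivity
    rw [mul_pow, ENNReal.ofReal_mul (by positivity), div_eq_mul_inv, div_eq_mul_inv,
      ENNReal.mul_inv (Or.inl h0) (Or.inl ENNReal.ofReal_ne_top)]
    calc _ = (ENNReal.ofReal (112 ^ n) * (ENNReal.ofReal (112 ^ n))⁻¹) *
          (μ (ball w (56 * S.r (i + m))) * (ENNReal.ofReal (S.r (i + m) ^ n))⁻¹) := by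
          rw [ENNReal.mul_inv_cancel h0 ENNReal.ofReal_ne_top, one_mul]
      _ = _ := by ring
  rw [e3]
  apply le_of_eq
  ring

end DMNet

/-- **The enhanced David–Mattila lattice** (Section 2 of Dąbrowski–Tolsa): for any compactly
supported Radon measure `μ` on `ℝ^d` with polynomial growth of degree `n`, there is a
hierarchical family of Borel "cubes" partitioning `supp μ`, with comparable balls whose
`5`-enlargements are disjoint within each generation, with small boundaries, and satisfying
the boundary-energy estimate of Lemma 2.5, with constant independent of the growth
constant `c`. -/
theorem statement_9 (d n : ℕ) (hd : 1 ≤ d) (hn : 1 ≤ n) (γ : ℝ) (hγ0 : 0 < γ) (hγ1 : γ < 1) :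
    ∃ C₀ A₀ Cγ : ℝ, 1 < C₀ ∧ 5000 * C₀ < A₀ ∧ 0 < Cγ ∧
      ∀ (μ : Measure (EuclideanSpace ℝ (Fin d))),
        IsFiniteMeasureOnCompacts μ →
        (∃ K : Set (EuclideanSpace ℝ (Fin d)), IsCompact K ∧ μ Kᶜ = 0) →
        ∀ c : ℝ,
        (∀ x ∈ measSupport μ, ∀ r : ℝ, 0 < r → μ (ball x r) ≤ ENNReal.ofReal (c * r ^ n)) →
        ∃ (k₀ : ℤ) (𝒟 : ℤ → Set (Set (EuclideanSpace ℝ (Fin d))))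
          (cen : ℤ → Set (EuclideanSpace ℝ (Fin d)) → EuclideanSpace ℝ (Fin d))
          (rad : ℤ → Set (EuclideanSpace ℝ (Fin d)) → ℝ),
          -- (1) each generation partitions the support into Borel pieces, and the
          -- generations are nested
          (∀ k : ℤ, k₀ ≤ k → ⋃₀ 𝒟 k = measSupport μ) ∧
          (∀ k : ℤ, k₀ ≤ k → ∀ Q ∈ 𝒟 k, MeasurableSet Q) ∧
          (∀ k : ℤ, k₀ ≤ k → ∀ Q ∈ 𝒟 k, ∀ Q' ∈ 𝒟 k, Q ≠ Q' → Disjoint Q Q') ∧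
          (∀ k l : ℤ, k₀ ≤ k → k < l → ∀ Q ∈ 𝒟 l, ∀ R ∈ 𝒟 k, Q ∩ R = ∅ ∨ Q ⊆ R) ∧
          -- (2) general position: centers, radii, and disjointness of the 5-enlarged balls
          (∀ k : ℤ, k₀ ≤ k → ∀ Q ∈ 𝒟 k,
            cen k Q ∈ measSupport μ ∧
            A₀ ^ (-k) ≤ rad k Q ∧ rad k Q ≤ C₀ * A₀ ^ (-k) ∧
            measSupport μ ∩ ball (cen k Q) (rad k Q) ⊆ Q ∧
            Q ⊆ measSupport μ ∩ ball (cen k Q) (28 * rad k Q)) ∧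
          (∀ k : ℤ, k₀ ≤ k → ∀ Q ∈ 𝒟 k, ∀ Q' ∈ 𝒟 k, Q ≠ Q' →
            Disjoint (ball (cen k Q) (5 * rad k Q)) (ball (cen k Q') (5 * rad k Q'))) ∧
          -- (3) small boundaries
          (∀ k : ℤ, k₀ ≤ k → ∀ Q ∈ 𝒟 k, ∀ l : ℕ,
            μ ({x ∈ measSupport μ \ Q | infDist x Q < A₀ ^ (-(k + (l : ℤ)))} ∪
                {x ∈ Q | infDist x (measSupport μ \ Q) < A₀ ^ (-(k + (l : ℤ)))}) ≤
              ENNReal.ofReal (A₀ ^ (-(γ * (l : ℝ)))) *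
                μ (ball (cen k Q) (90 * rad k Q))) ∧
          -- (4) the boundary-energy estimate, with `B_Q = B(x_Q, 28 r(Q))`,
          -- `2B_Q = B(x_Q, 56 r(Q))` and `2Q` the union of the same-generation cubes `P`
          -- with `dist(x_Q, P) ≤ 2 ℓ(Q)`
          (∀ k : ℤ, k₀ ≤ k → ∀ Q ∈ 𝒟 k,
            (∫⁻ x in ball (cen k Q) (56 * rad k Q) \ Q,
                (∫⁻ y in Q, (ENNReal.ofReal (dist x y ^ n))⁻¹ ∂μ) ^ 2 ∂μ) +
              (∫⁻ x in Q,
                (∫⁻ y in ball (cen k Q) (56 * rad k Q) \ Q,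
                  (ENNReal.ofReal (dist x y ^ n))⁻¹ ∂μ) ^ 2 ∂μ) ≤
              ENNReal.ofReal Cγ *
                ∑' P : {q : ℤ × Set (EuclideanSpace ℝ (Fin d)) //
                    k ≤ q.1 ∧ q.2 ∈ 𝒟 q.1 ∧
                    q.2 ⊆ ⋃₀ {P' | P' ∈ 𝒟 k ∧
                      infDist (cen k Q) P' ≤ 2 * sideLength C₀ A₀ k}},
                  ENNReal.ofReal ((sideLength C₀ A₀ P.1.1 / sideLength C₀ A₀ k) ^ γ) *
                    (μ (ball (cen P.1.1 P.1.2) (56 * rad P.1.1 P.1.2)) /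
                        ENNReal.ofReal (sideLength C₀ A₀ P.1.1 ^ n)) ^ 2 *
                    μ P.1.2) := by
  obtain ⟨D, hD0, hD⟩ := dm_doubling d
  obtain ⟨N, hN, b, hb, hbN⟩ := dm_constants D hD0 γ hγ1
  have hN' : (100 : ℝ) ≤ N := by exact_mod_cast hN
  set A : ℝ := 150 * N with hAdef
  have hA1 : 1 < A := by linarith
  have hA0 : 0 < A := by linarith
  refine ⟨2, A, (4 + 32 * (A ^ n) ^ 2) * (112 ^ n) ^ 2, by norm_num, by linarith,
    by positivity, ?_⟩
  intro μ hμc ⟨K, hK, hμK⟩ c hc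
  have : IsFiniteMeasure μ := by
    refine ⟨?_⟩
    calc μ univ = μ (K ∪ Kᶜ) := by rw [union_compl_self]
      _ ≤ μ K + μ Kᶜ := measure_union_le _ _
      _ = μ K := by rw [hμK, add_zero]
      _ < ∞ := hK.measure_lt_top
  have hEc : IsCompact (measSupport μ) :=
    hK.of_isClosed_subset (dm_isClosed_support μ) (dm_support_subset μ K hK hμK)
  have hμE := dm_support_compl_null μ
  -- choice of the first generation
  have hk₀ : ∃ k₀ : ℤ, measSupport μ = ∅ ∨
      ∃ p ∈ measSupport μ, ∃ p' ∈ measSupport μ, 26 * A ^ (-k₀) < dist p p' := by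
    rcases eq_empty_or_nonempty (measSupport μ) with h | ⟨p, hp⟩
    · exact ⟨0, Or.inl h⟩
    · obtain ⟨p', hp', hne⟩ := dm_support_nontrivial hn μ c hc p hp
      have hpos : 0 < dist p p' / 26 := by
        have := dist_pos.2 hne
        positivity
      obtain ⟨j, hj⟩ := exists_pow_lt_of_lt_one hpos (inv_lt_one_of_one_lt₀ hA1)
      refine ⟨j, Or.inr ⟨p, hp, p', hp', ?_⟩⟩
      rw [zpow_neg, zpow_natCast, ← inv_pow]
      linarith
  obtain ⟨k₀, hk₀⟩ := hk₀
  set g : ℝ≥0∞ := ENNReal.ofReal (A ^ (-γ)) with hg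
  obtain ⟨S, hSE, hSN, hSr, hgood⟩ := dm_exists_net μ n g (measSupport μ) hEc N (by omega) k₀
  have hr : ∀ i : ℕ, S.r i = A ^ (-(k₀ + i)) := hSr
  have hgpos : 0 < A ^ (-γ) := by positivity
  have hg0 : g ≠ 0 := by
    rw [hg]; simp only [ne_eq, ENNReal.ofReal_eq_zero, not_le]; exact hgpos
  set q : ℝ≥0∞ := D * (D * (2 / S.N)) with hq
  have hqr : q = ENNReal.ofReal (D * (D * (2 / N))) := by
    rw [hq, hSN, ENNReal.ofReal_mul (by positivity), ENNReal.ofReal_mul (by positivity),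
      ENNReal.ofReal_div_of_pos (by linarith)]
    simp
  have hbq : 2 * ENNReal.ofReal b ^ 2 * q ≤ g := by
    rw [hqr, hg, ← ENNReal.ofReal_pow (by linarith),
      show (2 : ℝ≥0∞) = ENNReal.ofReal 2 by simp,
      ← ENNReal.ofReal_mul (by norm_num), ← ENNReal.ofReal_mul (by positivity)]
    exact ENNReal.ofReal_le_ofReal hbN
  have hqg : q ≤ g := by
    rw [hqr, hg]
    apply ENNReal.ofReal_le_ofReal
    refine le_trans ?_ hbN
    apply le_mul_of_one_le_left (by positivity)
    nlinarith
  have hfar : ∀ i z, z ∈ S.X i → (measSupport μ \ S.Q i z).Nonempty := by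
    intro i z hz
    rcases hk₀ with h | ⟨p, hp, p', hp', hpp⟩
    · have := S.XE i z hz
      rw [hSE, h] at this
      exact absurd this (notMem_empty z)
    · by_contra hne
      have hall : ∀ y ∈ measSupport μ, y ∈ S.Q i z := fun y hy => by
        by_contra hyQ
        exact hne ⟨y, hy, hyQ⟩
      have h1 : dist p z < 13 * S.r i := S.Q_sub_ball i z (hall p hp)
      have h2 : dist p' z < 13 * S.r i := S.Q_sub_ball i z (hall p' hp')
      have h3 := S.r_anti 0 i
      have h4 : S.r 0 = A ^ (-k₀) := by rw [hr 0]; simp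
      rw [zero_add] at h3
      have h5 := dist_triangle_right p p' z
      linarith
  have hgen : ∀ k : ℤ, k₀ ≤ k → ∀ Q ∈ S.gen k₀ k, ∃ i : ℕ, k = k₀ + i ∧
      ∃ z ∈ S.X i, S.Q i z = Q := by
    intro k hk Q hQ
    obtain ⟨i, rfl⟩ := Int.le.dest hk
    exact ⟨i, rfl, (S.mem_gen k₀ i Q).1 hQ⟩
  refine ⟨k₀, S.gen k₀, S.cen k₀, fun k _ => A ^ (-k), ?_, ?_, ?_, ?_, ?_, ?_, ?_, ?_⟩
  · intro k hk
    obtain ⟨i, rfl⟩ := Int.le.dest hk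
    apply Subset.antisymm
    · rintro x ⟨Q, hQ, hx⟩
      obtain ⟨z, hz, rfl⟩ := (S.mem_gen k₀ i Q).1 hQ
      rw [← hSE]
      exact hx.1
    · intro x hx
      rw [← hSE] at hx
      exact ⟨S.Q i (S.L i x), (S.mem_gen k₀ i _).2 ⟨_, S.L_mem i x hx, rfl⟩, hx, rfl⟩
  · intro k hk Q hQ
    obtain ⟨i, rfl, z, hz, rfl⟩ := hgen k hk Q hQ
    exact S.measurable_Q i z
  · intro k hk Q hQ Q' hQ' hne
    obtain ⟨i, rfl⟩ := Int.le.dest hk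
    obtain ⟨z, hz, rfl⟩ := (S.mem_gen k₀ i Q).1 hQ
    obtain ⟨z', hz', rfl⟩ := (S.mem_gen k₀ i Q').1 hQ'
    rw [Set.disjoint_left]
    intro x hx hx'
    apply hne
    rw [hx.2.symm.trans hx'.2]
  · intro k l hk hkl Q hQ R hR
    obtain ⟨i, rfl⟩ := Int.le.dest hk
    obtain ⟨m, rfl⟩ := Int.le.dest hkl.le
    have e : k₀ + (i : ℤ) + (m : ℤ) = k₀ + ((i + m : ℕ) : ℤ) := by push_cast; ring
    rw [e] at hQ
    obtain ⟨w, hw, rfl⟩ := (S.mem_gen k₀ _ Q).1 hQ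
    obtain ⟨z, hz, rfl⟩ := (S.mem_gen k₀ i R).1 hR
    rcases eq_empty_or_nonempty (S.Q (i + m) w ∩ S.Q i z) with h | ⟨x, hx, hxz⟩
    · exact Or.inl h
    · refine Or.inr fun y hy => ⟨hy.1, ?_⟩
      exact (S.Q_nest i m w y x hy hx).trans hxz.2
  · intro k hk Q hQ
    obtain ⟨i, rfl, z, hz, rfl⟩ := hgen k hk Q hQ
    have hri := S.r_pos i
    beta_reduce
    rw [S.cen_Q k₀ i z hz, ← hr i, ← hSE]
    refine ⟨S.XE i z hz, le_rfl, by linarith, ?_, ?_⟩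
    · rintro x ⟨hx, hxb⟩
      exact ⟨hx, S.L_core i x z hx hz hxb⟩
    · intro x hx
      exact ⟨hx.1, ball_subset_ball (by linarith) (S.Q_sub_ball i z hx)⟩
  · intro k hk Q hQ Q' hQ' hne
    obtain ⟨i, rfl⟩ := Int.le.dest hk
    obtain ⟨z, hz, rfl⟩ := (S.mem_gen k₀ i Q).1 hQ
    obtain ⟨z', hz', rfl⟩ := (S.mem_gen k₀ i Q').1 hQ'
    beta_reduce
    rw [S.cen_Q k₀ i z hz, S.cen_Q k₀ i z' hz', ← hr i]
    apply ball_disjoint_ball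
    have := S.sep i z hz z' hz' (fun h => hne (by rw [h]))
    linarith
  · intro k hk Q hQ l
    obtain ⟨i, rfl, z, hz, rfl⟩ := hgen k hk Q hQ
    have hri := S.r_pos i
    beta_reduce
    rw [S.cen_Q k₀ i z hz, ← hr i]
    have e : k₀ + (i : ℤ) + (l : ℤ) = k₀ + ((i + l : ℕ) : ℤ) := by push_cast; ring
    rw [e, ← hr (i + l)]
    have hsub : ({x ∈ measSupport μ \ S.Q i z | infDist x (S.Q i z) < S.r (i + l)} ∪
                {x ∈ S.Q i z | infDist x (measSupport μ \ S.Q i z) < S.r (i + l)}) ⊆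
        S.Nb i l z := by
      rintro x (⟨⟨hxE, hxQ⟩, hx⟩ | ⟨hxQ, hx⟩)
      · obtain ⟨y, hy, hxy⟩ := (infDist_lt_iff ⟨z, S.mem_Q_self i z hz⟩).1 hx
        rw [← hSE] at hxE
        exact ⟨hxE, y, hy.1, hxy, Or.inr ⟨fun h => hxQ ⟨hxE, h⟩, hy.2⟩⟩
      · obtain ⟨y, hy, hxy⟩ := (infDist_lt_iff (hfar i z hz)).1 hx
        have hyE := hy.1
        rw [← hSE] at hyE
        exact ⟨hxQ.1, y, hyE, hxy, Or.inl ⟨hxQ.2, fun h => hy.2 ⟨hyE, h⟩⟩⟩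
    have hgl : ENNReal.ofReal (A ^ (-(γ * (l : ℝ)))) = g ^ l := by
      rw [hg, ← ENNReal.ofReal_pow hgpos.le, ← Real.rpow_natCast, ← Real.rpow_mul hA0.le]
      congr 2
      ring
    rw [hgl]
    refine (measure_mono hsub).trans ?_
    refine (S.mu_Nb μ (fun i z => S.Gs_sum hD μ i (fun j hj => (hgood i j hj).1) z)
      l i z).trans ?_
    exact mul_le_mul' (pow_le_pow_left' hqg l)
      (measure_mono (ball_subset_ball (by linarith)))
  · intro k hk Q hQ
    obtain ⟨i, rfl, z, hz, rfl⟩ := hgen k hk Q hQ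
    have hri := S.r_pos i
    beta_reduce
    have h1 := S.energy_full (b := ENNReal.ofReal b) (g := g)
      (by rw [show (2 : ℝ≥0∞) = ENNReal.ofReal 2 by simp]; exact ENNReal.ofReal_le_ofReal hb)
      ENNReal.ofReal_ne_top μ (by rw [hSE]; exact hμE) n i z hz
      (fun M => S.energy_Nb (dmSigma μ n S.r) (dmNu μ n S.r g)
        (dm_sigma_le_nu μ n S.r g) (dm_nu_succ μ n S.r g) hg0 ENNReal.ofReal_ne_top hbq
        (fun i z => S.Gs_sum hD _ i (fun j hj => (hgood i j hj).2) z) M i z)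
    have h2 := S.rhs_le μ n γ k₀ A hA1 hr i z hz
    have hCC : ENNReal.ofReal ((4 + 32 * (A ^ n) ^ 2) * (112 ^ n) ^ 2) =
        (4 + 32 * (ENNReal.ofReal (150 * S.N) ^ n) ^ 2) * (ENNReal.ofReal (112 ^ n)) ^ 2 := by
      rw [hSN, ← hAdef, ENNReal.ofReal_mul (by positivity),
        ENNReal.ofReal_add (by positivity) (by positivity),
        ENNReal.ofReal_mul (by positivity), ENNReal.ofReal_pow (by positivity),
        ENNReal.ofReal_pow hA0.le, ENNReal.ofReal_pow (p := 112 ^ n) (by positivity)]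
      norm_num
    rw [hCC, mul_assoc]
    refine le_trans ?_ (mul_le_mul_right h2 _)
    rw [S.cen_Q k₀ i z hz, ← hr i]
    exact h1

end
end

section
/- Let n ≥ 1 be an integer, 1 < p < ∞, and let μ be a Radon measure on ℝ^{n+1}. Let I be a countable index set and, for each i ∈ I, let x_i ∈ ℝ^{n+1}, r_i > 0 and Q_i ⊂ B(x_i, r_i) be nonempty Borel sets which are pairwise disjoint and satisfy μ(Q_i) < ∞. Define D(i,j) = r_i + r_j + dist(Q_i, Q_j), the coefficients 𝒬_i = Σ_{j∈I} r_j μ(Q_j) / D(i,j)^{n+1}, and 𝒫_i = Σ_{k≥0} 2^{−k} μ(B(x_i, 2^k r_i)) / (2^k r_i)^n. Then Σ_{i∈I} 𝒬_i^p μ(Q_i) ≤ C Σ_{i∈I} 𝒫_i^p μ(Q_i), where C depends only on n and p. -/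
open MeasureTheory Metric Set ENNReal

noncomputable section

/-- The distance between two sets: `dist(s,t) = inf { dist x y | x ∈ s, y ∈ t }`. -/
def setDist {X : Type*} [PseudoEMetricSpace X] (s t : Set X) : ℝ :=
  (⨅ x ∈ s, EMetric.infEdist x t).toReal

/-- The long-range interaction coefficient
`𝒬_i = ∑_j r_j μ(Q_j) / D(i,j)^{n+1}` with `D(i,j) = r_i + r_j + dist(Q_i,Q_j)`. -/
def coefQ (n : ℕ) {I : Type*} (μ : Measure (EuclideanSpace ℝ (Fin (n + 1))))
    (r : I → ℝ) (Q : I → Set (EuclideanSpace ℝ (Fin (n + 1)))) (i : I) : ℝ≥0∞ :=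
  ∑' j : I, ENNReal.ofReal (r j) * μ (Q j) /
    ENNReal.ofReal ((r i + r j + setDist (Q i) (Q j)) ^ (n + 1))

/-- The Poisson-type coefficient `𝒫_i = ∑_{k≥0} 2^{-k} μ(B(x_i, 2^k r_i)) / (2^k r_i)^n`. -/
def coefP (n : ℕ) {I : Type*} (μ : Measure (EuclideanSpace ℝ (Fin (n + 1))))
    (x : I → EuclideanSpace ℝ (Fin (n + 1))) (r : I → ℝ) (i : I) : ℝ≥0∞ :=
  ∑' k : ℕ, ((2 : ℝ≥0∞) ^ k)⁻¹ *
    (μ (ball (x i) (2 ^ k * r i)) / ENNReal.ofReal ((2 ^ k * r i) ^ n))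

theorem aux_order {I : Type*} (F : Finset I) (a : I → ℝ≥0∞) (d : I → ℝ) (p : ℝ) (hp : 1 < p)
    (hfin : ∀ j ∈ F, a j ≠ ⊤) :
    (∑ j ∈ F, a j) ^ p ≤
      2 ^ p * ∑ j ∈ F, a j * (∑ k ∈ F with d j ≤ d k, a k) ^ (p - 1) := by
  classical
  set S := ∑ j ∈ F, a j with hS
  have hStop : S ≠ ⊤ := by
    rw [hS]; exact (ENNReal.sum_ne_top).2 hfin
  set T : I → ℝ≥0∞ := fun j => ∑ k ∈ F with d j ≤ d k, a k with hT
  have hsmall : ∑ j ∈ F with ¬ (S / 2 ≤ T j), a j ≤ S / 2 := by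
    rcases (F.filter (fun j => ¬ (S / 2 ≤ T j))).eq_empty_or_nonempty with h | h
    · rw [h]; simp
    · obtain ⟨j, hj, hmin⟩ := Finset.exists_min_image _ d h
      have hj2 := (Finset.mem_filter.1 hj).2
      refine le_trans ?_ (not_le.1 hj2).le
      refine Finset.sum_le_sum_of_subset ?_
      intro k hk
      exact Finset.mem_filter.2 ⟨(Finset.mem_filter.1 hk).1, hmin k hk⟩
  have hsplit : (∑ j ∈ F with S / 2 ≤ T j, a j) + ∑ j ∈ F with ¬ (S / 2 ≤ T j), a j = S :=
    Finset.sum_filter_add_sum_filter_not F _ _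
  have hbig : S / 2 ≤ ∑ j ∈ F with S / 2 ≤ T j, a j := by
    have h1 : S / 2 + S / 2 ≤ (∑ j ∈ F with S / 2 ≤ T j, a j) + S / 2 := by
      rw [ENNReal.add_halves]
      calc S = _ := hsplit.symm
        _ ≤ _ := by gcongr
    exact (ENNReal.add_le_add_iff_right (ENNReal.div_ne_top hStop (by simp))).1 h1
  have key : (S / 2) ^ p ≤ ∑ j ∈ F, a j * T j ^ (p - 1) := by
    calc (S / 2) ^ p = (S / 2) ^ (1 + (p - 1)) := by ring_nf
      _ = (S / 2) * (S / 2) ^ (p - 1) := by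
        rw [ENNReal.rpow_add_of_nonneg _ _ (by norm_num) (by linarith), ENNReal.rpow_one]
      _ ≤ (∑ j ∈ F with S / 2 ≤ T j, a j) * (S / 2) ^ (p - 1) := by gcongr
      _ = ∑ j ∈ F with S / 2 ≤ T j, a j * (S / 2) ^ (p - 1) := Finset.sum_mul _ _ _
      _ ≤ ∑ j ∈ F with S / 2 ≤ T j, a j * T j ^ (p - 1) := by
        refine Finset.sum_le_sum fun j hj => ?_
        have := (Finset.mem_filter.1 hj).2
        have hp1 : 0 ≤ p - 1 := by linarith
        gcongr
      _ ≤ _ := Finset.sum_le_sum_of_subset (Finset.filter_subset _ _)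
  calc S ^ p = (2 * (S / 2)) ^ p := by
        rw [ENNReal.mul_div_cancel (by simp) (by simp)]
    _ = 2 ^ p * (S / 2) ^ p := ENNReal.mul_rpow_of_nonneg _ _ (by linarith)
    _ ≤ _ := by gcongr

theorem aux_young (p : ℝ) (hp : 1 < p) (K : ℝ≥0∞) (hK0 : K ≠ 0) (hK : K ≠ ⊤) (q P : ℝ≥0∞) :
    K * (q ^ (p - 1) * P) ≤ K * ((2 * K) ^ (p - 1) * P ^ p) + q ^ p / 2 := by
  have hp1 : 0 ≤ p - 1 := by linarith
  have e : ∀ t : ℝ≥0∞, t ^ p = t ^ (p - 1) * t := fun t => by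
    calc t ^ p = t ^ ((p - 1) + 1) := by ring_nf
      _ = _ := by rw [ENNReal.rpow_add_of_nonneg _ _ hp1 (by norm_num), ENNReal.rpow_one]
  rcases le_total q (2 * K * P) with h | h
  · refine le_trans ?_ le_self_add
    rw [e P, ← mul_assoc ((2 * K) ^ (p - 1)), ← ENNReal.mul_rpow_of_nonneg _ _ hp1]
    gcongr
  · refine le_trans ?_ le_add_self
    rw [e q, mul_div_assoc, mul_left_comm]
    gcongr
    rw [ENNReal.le_div_iff_mul_le (by simp) (by simp)]
    calc K * P * 2 = 2 * K * P := by ring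
      _ ≤ q := h

theorem aux_abs {I : Type*} (F : Finset I) (m w P : I → ℝ≥0∞) (κ : I → I → ℝ≥0∞)
    (d : I → I → ℝ) (p : ℝ) (hp : 1 < p) (L : ℝ≥0∞) (hL1 : 1 ≤ L) (hL : L ≠ ⊤)
    (hm : ∀ i, m i ≠ ⊤) (hw : ∀ i, w i ≠ ⊤) (hκt : ∀ i j, κ i j ≠ ⊤)
    (hκ : ∀ i j k, d i j ≤ d i k → κ i k ≤ L * κ j k)
    (hP : ∀ j, w j * ∑ i ∈ F, m i * κ i j ≤ L * P j) :
    ∑ i ∈ F, (∑ j ∈ F, w j * m j * κ i j) ^ p * m i ≤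
      (2 * (2 ^ p * L ^ (p - 1) * L)) ^ p * ∑ i ∈ F, P i ^ p * m i := by
  have hp1 : 0 ≤ p - 1 := by linarith
  set q : I → ℝ≥0∞ := fun i => ∑ j ∈ F, w j * m j * κ i j with hq
  set K : ℝ≥0∞ := 2 ^ p * L ^ (p - 1) * L with hK
  have hL0 : L ≠ 0 := fun h => by simp [h] at hL1
  have hKt : K ≠ ⊤ := by
    rw [hK]
    exact ENNReal.mul_ne_top (ENNReal.mul_ne_top
      (ENNReal.rpow_ne_top_of_nonneg (by linarith) (by simp))
      (ENNReal.rpow_ne_top_of_nonneg hp1 hL)) hL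
  have hK0 : K ≠ 0 := by
    rw [hK]
    refine mul_ne_zero (mul_ne_zero ?_ ?_) hL0
    · exact (ENNReal.rpow_pos (by simp) (by simp)).ne'
    · exact (ENNReal.rpow_pos (pos_iff_ne_zero.2 hL0) hL).ne'
  have hat : ∀ i j, w j * m j * κ i j ≠ ⊤ := fun i j =>
    ENNReal.mul_ne_top (ENNReal.mul_ne_top (hw j) (hm j)) (hκt i j)
  have hqt : ∀ i, q i ≠ ⊤ := fun i => (ENNReal.sum_ne_top).2 fun j _ => hat i j
  have hXt : ∑ i ∈ F, q i ^ p * m i ≠ ⊤ := (ENNReal.sum_ne_top).2 fun i _ =>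
    ENNReal.mul_ne_top (ENNReal.rpow_ne_top_of_nonneg (by linarith) (hqt i)) (hm i)
  have h1 : ∀ i, q i ^ p ≤ 2 ^ p * ∑ j ∈ F, w j * m j * κ i j * (L * q j) ^ (p - 1) := by
    intro i
    refine (aux_order F (fun j => w j * m j * κ i j) (d i) p hp fun j _ => hat i j).trans ?_
    gcongr with j hj
    calc ∑ k ∈ F with d i j ≤ d i k, w k * m k * κ i k
        ≤ ∑ k ∈ F with d i j ≤ d i k, L * (w k * m k * κ j k) := by
          refine Finset.sum_le_sum fun k hk => ?_
          calc w k * m k * κ i k ≤ w k * m k * (L * κ j k) := by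
                gcongr; exact hκ i j k (Finset.mem_filter.1 hk).2
            _ = _ := by ring
      _ ≤ ∑ k ∈ F, L * (w k * m k * κ j k) :=
          Finset.sum_le_sum_of_subset (Finset.filter_subset _ _)
      _ = L * q j := by rw [hq, Finset.mul_sum]
  have h2 : ∑ i ∈ F, q i ^ p * m i ≤ ∑ j ∈ F, K * (q j ^ (p - 1) * P j) * m j := by
    calc ∑ i ∈ F, q i ^ p * m i
        ≤ ∑ i ∈ F, (2 ^ p * ∑ j ∈ F, w j * m j * κ i j * (L * q j) ^ (p - 1)) * m i := by
          gcongr with i hi; exact h1 i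
      _ = ∑ i ∈ F, ∑ j ∈ F, 2 ^ p * (L * q j) ^ (p - 1) * m j * (w j * (m i * κ i j)) := by
          refine Finset.sum_congr rfl fun i _ => ?_
          rw [Finset.mul_sum, Finset.sum_mul]
          refine Finset.sum_congr rfl fun j _ => ?_
          ring
      _ = ∑ j ∈ F, 2 ^ p * (L * q j) ^ (p - 1) * m j * (w j * ∑ i ∈ F, m i * κ i j) := by
          rw [Finset.sum_comm]
          refine Finset.sum_congr rfl fun j _ => ?_
          rw [← Finset.mul_sum, ← Finset.mul_sum]
      _ ≤ ∑ j ∈ F, 2 ^ p * (L * q j) ^ (p - 1) * m j * (L * P j) := by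
          exact Finset.sum_le_sum fun j _ => mul_le_mul_right (hP j) _
      _ = _ := by
          refine Finset.sum_congr rfl fun j _ => ?_
          rw [ENNReal.mul_rpow_of_nonneg _ _ hp1, hK]
          ring
  have h3 : ∑ i ∈ F, q i ^ p * m i ≤
      K * (2 * K) ^ (p - 1) * (∑ i ∈ F, P i ^ p * m i) + (∑ i ∈ F, q i ^ p * m i) / 2 := by
    refine h2.trans ?_
    calc ∑ j ∈ F, K * (q j ^ (p - 1) * P j) * m j
        ≤ ∑ j ∈ F, (K * ((2 * K) ^ (p - 1) * P j ^ p) + q j ^ p / 2) * m j := by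
          gcongr with j hj; exact aux_young p hp K hK0 hKt _ _
      _ = _ := by
          rw [Finset.mul_sum, div_eq_mul_inv, Finset.sum_mul, ← Finset.sum_add_distrib]
          refine Finset.sum_congr rfl fun j _ => ?_
          rw [div_eq_mul_inv]
          ring
  set X := ∑ i ∈ F, q i ^ p * m i with hX
  have h4 : X / 2 ≤ K * (2 * K) ^ (p - 1) * (∑ i ∈ F, P i ^ p * m i) := by
    have : X / 2 + X / 2 ≤ K * (2 * K) ^ (p - 1) * (∑ i ∈ F, P i ^ p * m i) + X / 2 := by
      rw [ENNReal.add_halves]; exact h3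
    exact (ENNReal.add_le_add_iff_right (ENNReal.div_ne_top hXt (by simp))).1 this
  calc X = 2 * (X / 2) := (ENNReal.mul_div_cancel (by simp) (by simp)).symm
    _ ≤ 2 * (K * (2 * K) ^ (p - 1) * (∑ i ∈ F, P i ^ p * m i)) := by gcongr
    _ = (2 * K) ^ (p - 1) * (2 * K) * ∑ i ∈ F, P i ^ p * m i := by ring
    _ = (2 * K) ^ p * ∑ i ∈ F, P i ^ p * m i := by
        congr 1
        calc (2 * K) ^ (p - 1) * (2 * K) = (2 * K) ^ (p - 1) * (2 * K) ^ (1 : ℝ) := by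
              rw [ENNReal.rpow_one]
          _ = (2 * K) ^ (p - 1 + 1) := by
              rw [ENNReal.rpow_add_of_nonneg _ _ hp1 (by norm_num)]
          _ = _ := by ring_nf

theorem setDist_nn {X : Type*} [PseudoMetricSpace X] (s t : Set X) : 0 ≤ setDist s t :=
  ENNReal.toReal_nonneg

theorem setDist_le {X : Type*} [PseudoMetricSpace X] {s t : Set X} {x y : X} (hx : x ∈ s)
    (hy : y ∈ t) : setDist s t ≤ dist x y := by
  rw [← ENNReal.toReal_ofReal (dist_nonneg (x := x) (y := y)), ← edist_dist]
  refine ENNReal.toReal_mono (edist_ne_top x y) ?_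
  exact (iInf₂_le x hx).trans (Metric.infEDist_le_edist_of_mem hy)

theorem setDist_exists {X : Type*} [PseudoMetricSpace X] {s t : Set X} (hs : s.Nonempty)
    (ht : t.Nonempty) {ε : ℝ} (hε : 0 < ε) :
    ∃ x ∈ s, ∃ y ∈ t, dist x y < setDist s t + ε := by
  obtain ⟨x0, hx0⟩ := hs
  obtain ⟨y0, hy0⟩ := ht
  by_contra! h
  have hle : ENNReal.ofReal (setDist s t + ε) ≤ ⨅ x ∈ s, Metric.infEDist x t := by
    refine le_iInf₂ fun x hx => ?_
    rw [Metric.le_infEDist]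
    intro y hy
    rw [edist_dist]
    exact ENNReal.ofReal_le_ofReal (h x hx y hy)
  have htop : (⨅ x ∈ s, Metric.infEDist x t) ≠ ⊤ :=
    ne_top_of_le_ne_top (edist_ne_top x0 y0)
      ((iInf₂_le x0 hx0).trans (Metric.infEDist_le_edist_of_mem hy0))
  have := (ENNReal.ofReal_le_iff_le_toReal htop).1 hle
  have h2 : (⨅ x ∈ s, Metric.infEDist x t).toReal = setDist s t := rfl
  rw [h2] at this
  linarith

section geo
variable {E : Type*} [PseudoMetricSpace E] {I : Type*} (x : I → E) (r : I → ℝ) (Q : I → Set E)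

/-- The quantity `D(i,j)`. -/
def auxD (r : I → ℝ) (Q : I → Set E) (i j : I) : ℝ := r i + r j + setDist (Q i) (Q j)

theorem auxD_quasi (hne : ∀ i, (Q i).Nonempty) (hr : ∀ i, 0 < r i)
    (hsub : ∀ i, Q i ⊆ ball (x i) (r i)) (i j k : I) (h : auxD r Q i j ≤ auxD r Q i k) :
    auxD r Q j k ≤ 4 * auxD r Q i k := by
  refine le_of_forall_pos_le_add fun ε hε => ?_
  obtain ⟨a, ha, b, hb, hab⟩ := setDist_exists (hne i) (hne j) (half_pos hε)
  obtain ⟨c, hc, e, he, hce⟩ := setDist_exists (hne i) (hne k) (half_pos hε)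
  have h1 := setDist_le hb he
  have h2 := mem_ball.1 (hsub i ha)
  have h3 := mem_ball.1 (hsub i hc)
  have h4 := dist_triangle4 b a c e
  have h5 := dist_triangle_right a c (x i)
  rw [dist_comm b a] at h4
  have n1 := setDist_nn (Q i) (Q j)
  have n2 := setDist_nn (Q i) (Q k)
  have := hr i
  have := hr j
  have := hr k
  unfold auxD at *
  linarith

theorem auxD_ball (hne : ∀ i, (Q i).Nonempty) (hr : ∀ i, 0 < r i)
    (hsub : ∀ i, Q i ⊆ ball (x i) (r i)) (i j : I) :
    Q i ⊆ ball (x j) (2 * auxD r Q i j) := by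
  intro y hy
  obtain ⟨a, ha, b, hb, hab⟩ := setDist_exists (hne i) (hne j) (hr j)
  have h1 := mem_ball.1 (hsub i ha)
  have h2 := mem_ball.1 (hsub i hy)
  have h3 := mem_ball.1 (hsub j hb)
  have h4 := dist_triangle4 y a b (x j)
  have h5 := dist_triangle_right y a (x i)
  have n1 := setDist_nn (Q i) (Q j)
  rw [mem_ball]
  unfold auxD
  linarith

end geo

theorem auxP (n : ℕ) {I : Type*} (μ : Measure (EuclideanSpace ℝ (Fin (n + 1))))
    (x : I → EuclideanSpace ℝ (Fin (n + 1))) (r : I → ℝ)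
    (Q : I → Set (EuclideanSpace ℝ (Fin (n + 1)))) (hr : ∀ i, 0 < r i)
    (hne : ∀ i, (Q i).Nonempty) (hmeas : ∀ i, MeasurableSet (Q i))
    (hsub : ∀ i, Q i ⊆ ball (x i) (r i)) (hdis : Pairwise fun i j => Disjoint (Q i) (Q j))
    (F : Finset I) (j : I) :
    ENNReal.ofReal (r j) * ∑ i ∈ F, μ (Q i) * (ENNReal.ofReal (auxD r Q i j ^ (n + 1)))⁻¹ ≤
      4 ^ (n + 1) * coefP n μ x r j := by
  set c : ℕ → ℝ≥0∞ := fun k => 4 ^ (n + 1) * (ENNReal.ofReal ((2 ^ k * r j) ^ (n + 1)))⁻¹ with hc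
  have hpt : ∀ i, μ (Q i) * (ENNReal.ofReal (auxD r Q i j ^ (n + 1)))⁻¹ ≤
      ∑' k : ℕ, c k * μ (Q i ∩ ball (x j) (2 ^ k * r j)) := by
    intro i
    have hrj := hr j
    have hDr : r j ≤ auxD r Q i j := by
      have := hr i
      have := setDist_nn (Q i) (Q j)
      unfold auxD; linarith
    have hD0 : 0 < auxD r Q i j := hrj.trans_le hDr
    obtain ⟨k, hk1, hk2⟩ := exists_nat_pow_near (x := 2 * auxD r Q i j / r j) (y := 2)
      (by rw [le_div_iff₀ hrj]; linarith) (by norm_num)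
    rw [le_div_iff₀ hrj] at hk1
    rw [div_lt_iff₀ hrj] at hk2
    refine le_trans ?_ (ENNReal.le_tsum (k + 1))
    have hsb : Q i ∩ ball (x j) (2 ^ (k + 1) * r j) = Q i :=
      inter_eq_left.2 ((auxD_ball x r Q hne hr hsub i j).trans (ball_subset_ball hk2.le))
    rw [hsb, mul_comm]
    gcongr
    rw [hc]
    have hb : 0 < 2 ^ (k + 1) * r j := by positivity
    have h4 : (4 : ℝ≥0∞) ^ (n + 1) = ENNReal.ofReal (4 ^ (n + 1)) := by
      rw [ENNReal.ofReal_pow (by norm_num)]; norm_num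
    simp only
    rw [h4, ← ENNReal.ofReal_inv_of_pos (by positivity), ← ENNReal.ofReal_inv_of_pos (by positivity),
      ← ENNReal.ofReal_mul (by positivity)]
    refine ENNReal.ofReal_le_ofReal ?_
    rw [← inv_pow, ← inv_pow, ← mul_pow]
    refine pow_le_pow_left₀ (by positivity) ?_ _
    rw [inv_eq_one_div, ← div_eq_mul_inv, div_le_div_iff₀ hD0 hb, pow_succ]
    linarith
  calc ENNReal.ofReal (r j) * ∑ i ∈ F, μ (Q i) * (ENNReal.ofReal (auxD r Q i j ^ (n + 1)))⁻¹
      ≤ ENNReal.ofReal (r j) * ∑ i ∈ F, ∑' k : ℕ, c k * μ (Q i ∩ ball (x j) (2 ^ k * r j)) := by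
        gcongr with i hi; exact hpt i
    _ = ENNReal.ofReal (r j) * ∑' k : ℕ, c k * ∑ i ∈ F, μ (Q i ∩ ball (x j) (2 ^ k * r j)) := by
        rw [← Summable.tsum_finsetSum (fun _ _ => ENNReal.summable)]
        simp_rw [Finset.mul_sum]
    _ ≤ ENNReal.ofReal (r j) * ∑' k : ℕ, c k * μ (ball (x j) (2 ^ k * r j)) := by
        gcongr with k
        rw [← measure_biUnion_finset]
        · exact measure_mono (iUnion₂_subset fun i _ => inter_subset_right)
        · intro a _ b _ hab
          exact (hdis hab).mono inter_subset_left inter_subset_left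
        · exact fun i _ => (hmeas i).inter measurableSet_ball
    _ = 4 ^ (n + 1) * coefP n μ x r j := by
        unfold coefP
        rw [← ENNReal.tsum_mul_left, ← ENNReal.tsum_mul_left]
        refine tsum_congr fun k => ?_
        have hrj := hr j
        have e1 : (ENNReal.ofReal ((2 ^ k * r j) ^ (n + 1)))⁻¹ =
            (ENNReal.ofReal ((2 ^ k * r j) ^ n))⁻¹ * ((2 ^ k)⁻¹ * (ENNReal.ofReal (r j))⁻¹) := by
          have h2 : ((2 : ℝ≥0∞) ^ k)⁻¹ = ENNReal.ofReal ((2 ^ k)⁻¹) := by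
            rw [ENNReal.ofReal_inv_of_pos (by positivity), ENNReal.ofReal_pow (by norm_num)]
            norm_num
          rw [h2, ← ENNReal.ofReal_inv_of_pos (by positivity),
            ← ENNReal.ofReal_inv_of_pos (by positivity),
            ← ENNReal.ofReal_inv_of_pos (by positivity),
            ← ENNReal.ofReal_mul (by positivity), ← ENNReal.ofReal_mul (by positivity)]
          congr 1
          rw [pow_succ, mul_inv, mul_inv (2 ^ k)]
        rw [hc]
        simp only
        rw [e1, div_eq_mul_inv]
        have h3 : ENNReal.ofReal (r j) * (ENNReal.ofReal (r j))⁻¹ = 1 :=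
          ENNReal.mul_inv_cancel (by simpa using hrj) (by simp)
        calc _ = (ENNReal.ofReal (r j) * (ENNReal.ofReal (r j))⁻¹) * (4 ^ (n + 1) *
              ((2 ^ k)⁻¹ * (μ (ball (x j) (2 ^ k * r j)) *
                (ENNReal.ofReal ((2 ^ k * r j) ^ n))⁻¹))) := by ring
          _ = _ := by rw [h3, one_mul]

/-- **Lemma 7.12 of Dąbrowski–Tolsa (abstract form):** for a countable family of pairwise
disjoint nonempty Borel sets `Q_i ⊆ B(x_i,r_i)` of finite measure, the long-range
interaction coefficients `𝒬_i` are dominated in every `L^p(μ)`-type sum by the Poisson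
coefficients `𝒫_i`, with constant depending only on `n` and `p`. -/
theorem statement_13 (n : ℕ) (hn : 1 ≤ n) (p : ℝ) (hp : 1 < p) :
    ∃ C : ℝ, 0 < C ∧
      ∀ (μ : Measure (EuclideanSpace ℝ (Fin (n + 1)))),
        IsLocallyFiniteMeasure μ →
        ∀ (I : Type), Countable I →
        ∀ (x : I → EuclideanSpace ℝ (Fin (n + 1))) (r : I → ℝ)
          (Q : I → Set (EuclideanSpace ℝ (Fin (n + 1)))),
        (∀ i, 0 < r i) →
        (∀ i, (Q i).Nonempty) →
        (∀ i, MeasurableSet (Q i)) →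
        (∀ i, Q i ⊆ ball (x i) (r i)) →
        (Pairwise fun i j => Disjoint (Q i) (Q j)) →
        (∀ i, μ (Q i) < ⊤) →
        (∑' i : I, coefQ n μ r Q i ^ p * μ (Q i)) ≤
          ENNReal.ofReal C * ∑' i : I, coefP n μ x r i ^ p * μ (Q i) := by
  set C : ℝ≥0∞ := (2 * (2 ^ p * (4 ^ (n + 1)) ^ (p - 1) * 4 ^ (n + 1))) ^ p with hC
  have hp1 : 0 ≤ p - 1 := by linarith
  have hL : (4 : ℝ≥0∞) ^ (n + 1) ≠ ⊤ := by simp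
  have hCt : C ≠ ⊤ := by
    rw [hC]
    refine ENNReal.rpow_ne_top_of_nonneg (by linarith) ?_
    exact ENNReal.mul_ne_top (by simp) (ENNReal.mul_ne_top (ENNReal.mul_ne_top
      (ENNReal.rpow_ne_top_of_nonneg (by linarith) (by simp))
      (ENNReal.rpow_ne_top_of_nonneg hp1 hL)) hL)
  refine ⟨C.toReal + 1, by positivity, ?_⟩
  intro μ _ I _ x r Q hr hne hmeas hsub hdis hfin
  have hCle : C ≤ ENNReal.ofReal (C.toReal + 1) := by
    rw [← ENNReal.ofReal_toReal hCt]
    exact ENNReal.ofReal_le_ofReal (by simp)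
  have hDpos : ∀ i j, 0 < auxD r Q i j := fun i j => by
    have := hr i
    have := hr j
    have := setDist_nn (Q i) (Q j)
    unfold auxD; linarith
  have main : ∀ F : Finset I,
      ∑ i ∈ F, (∑ j ∈ F, ENNReal.ofReal (r j) * μ (Q j) /
        ENNReal.ofReal ((r i + r j + setDist (Q i) (Q j)) ^ (n + 1))) ^ p * μ (Q i) ≤
      ENNReal.ofReal (C.toReal + 1) * ∑' i : I, coefP n μ x r i ^ p * μ (Q i) := by
    intro F
    have := aux_abs F (fun i => μ (Q i)) (fun i => ENNReal.ofReal (r i)) (coefP n μ x r)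
      (fun i j => (ENNReal.ofReal (auxD r Q i j ^ (n + 1)))⁻¹) (auxD r Q) p hp (4 ^ (n + 1))
      (one_le_pow₀ (by norm_num)) hL (fun i => (hfin i).ne) (fun i => by simp)
      (fun i j => by
        have := pow_pos (hDpos i j) (n + 1)
        simpa using this) ?_ (auxP n μ x r Q hr hne hmeas hsub hdis F)
    · refine le_trans this ?_
      gcongr
      exact ENNReal.sum_le_tsum F
    · intro i j k h
      have hq := auxD_quasi x r Q hne hr hsub i j k h
      have h1 := hDpos i k
      have h2 := hDpos j k
      have h4 : (4 : ℝ≥0∞) ^ (n + 1) = ENNReal.ofReal (4 ^ (n + 1)) := by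
        rw [ENNReal.ofReal_pow (by norm_num)]; norm_num
      rw [h4, ← ENNReal.ofReal_inv_of_pos (by positivity),
        ← ENNReal.ofReal_inv_of_pos (by positivity), ← ENNReal.ofReal_mul (by positivity)]
      refine ENNReal.ofReal_le_ofReal ?_
      rw [← inv_pow, ← inv_pow, ← mul_pow]
      refine pow_le_pow_left₀ (by positivity) ?_ _
      rw [inv_eq_one_div, ← div_eq_mul_inv, div_le_div_iff₀ h1 h2]
      linarith
  rw [ENNReal.tsum_eq_iSup_sum]
  refine iSup_le fun G => ?_
  have hlim : Filter.Tendsto (fun F : Finset I =>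
      ∑ i ∈ G, (∑ j ∈ F, ENNReal.ofReal (r j) * μ (Q j) /
        ENNReal.ofReal ((r i + r j + setDist (Q i) (Q j)) ^ (n + 1))) ^ p * μ (Q i))
      Filter.atTop (nhds (∑ i ∈ G, coefQ n μ r Q i ^ p * μ (Q i))) := by
    refine tendsto_finsetSum _ fun i _ => ?_
    refine ENNReal.Tendsto.mul_const ?_ (Or.inr (hfin i).ne)
    exact (ENNReal.continuous_rpow_const.tendsto _).comp ENNReal.summable.hasSum
  refine le_of_tendsto hlim ?_
  filter_upwards [Filter.eventually_ge_atTop G] with F hF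
  exact (Finset.sum_le_sum_of_subset hF).trans (main F)

end
end
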